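/- arXiv:2404.04523 — 2 statements merged into one kernel-verified Lean document; each statement's English description precedes it below -/
import Mathlib

section
/- There exist absolute constants C₁, C₂ > 0 such that for every δ ≥ 1 there is a constant γ₁(δ) > 0 (depending only on δ) with the following property: for every unidirectional Stokes wave solution (ψ, η, r) with γ > γ₁(δ), R(s_c) < r < R(0), and ψ_y(0, η(0)) ≥ √(2γ) − δ/γ at the crest, one has ψ_y(x, y) ≥ C₁·γ·δ⁻¹·y for all (x, y) in the closure of D_η, and moreover η̂ ≤ C₂·δ·√(2/γ). -/
noncomputable section

open Real Set

/-- Partial derivative of `ψ` in the horizontal variable. -/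
def px (ψ : ℝ → ℝ → ℝ) (x y : ℝ) : ℝ := deriv (fun t => ψ t y) x

/-- Partial derivative of `ψ` in the vertical variable. -/
def py (ψ : ℝ → ℝ → ℝ) (x y : ℝ) : ℝ := deriv (fun t => ψ x t) y

/-- Second partial derivative in `x`. -/
def pxx (ψ : ℝ → ℝ → ℝ) (x y : ℝ) : ℝ := deriv (fun t => px ψ t y) x

/-- Second partial derivative in `y`. -/
def pyy (ψ : ℝ → ℝ → ℝ) (x y : ℝ) : ℝ := deriv (fun t => py ψ x t) y

/-- Depth `d(s)` of the laminar (stream) flow with surface value `s` of `ψ_y`. -/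
def lamDepth (γ s : ℝ) : ℝ := (-s + Real.sqrt (s ^ 2 + 2 * γ)) / γ

/-- Bernoulli constant `R(s) = ½ s² + γ + d(s)` of the laminar flow. -/
def bernR (γ s : ℝ) : ℝ := s ^ 2 / 2 + γ + lamDepth γ s

/-- `s` is the (unique) positive critical point `s_c` of `R`, characterized by the
equation `s - 1/γ + s/(γ √(s² + 2γ)) = 0`. -/
def IsCrit (γ s : ℝ) : Prop :=
  0 < s ∧ s - 1 / γ + s / (γ * Real.sqrt (s ^ 2 + 2 * γ)) = 0

/-- A solution `(ψ, η, r)` of the stream-function formulation with constant adverse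
vorticity `ω = -γ`:  `Δψ = γ` in the fluid domain `D_η`, the Bernoulli condition on the
surface, `ψ = 1` on the surface and `ψ = 0` on the flat bottom. -/
structure StreamSolution (γ : ℝ) (ψ : ℝ → ℝ → ℝ) (η : ℝ → ℝ) (r : ℝ) : Prop where
  eta_smooth : ContDiff ℝ (⊤ : ℕ∞) η
  eta_pos : ∀ x, 0 < η x
  psi_smooth : ContDiff ℝ (⊤ : ℕ∞) (fun p : ℝ × ℝ => ψ p.1 p.2)
  laplace : ∀ x y, 0 < y → y < η x → pxx ψ x y + pyy ψ x y = γ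
  bernoulli : ∀ x, (px ψ x (η x)) ^ 2 / 2 + (py ψ x (η x)) ^ 2 / 2 + η x = r
  surface_val : ∀ x, ψ x (η x) = 1
  bottom_val : ∀ x, ψ x 0 = 0

/-- The flow is unidirectional: `ψ_y > 0` everywhere in the fluid domain `D_η`. -/
def Unidirectional (ψ : ℝ → ℝ → ℝ) (η : ℝ → ℝ) : Prop :=
  ∀ x y, 0 < y → y < η x → 0 < py ψ x y

/-- A Stokes wave with half-period `Λ`: the solution is `2Λ`-periodic and even in `x`,
and the surface profile is strictly decreasing from the crest (`x = 0`) to the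
trough (`x = Λ`).  Thus `η̂ = max η = η 0` and `η̌ = min η = η Λ`. -/
structure StokesWave (γ : ℝ) (ψ : ℝ → ℝ → ℝ) (η : ℝ → ℝ) (r Λ : ℝ) : Prop where
  sol : StreamSolution γ ψ η r
  lam_pos : 0 < Λ
  eta_periodic : ∀ x, η (x + 2 * Λ) = η x
  eta_even : ∀ x, η (-x) = η x
  psi_periodic : ∀ x y, ψ (x + 2 * Λ) y = ψ x y
  psi_even : ∀ x y, ψ (-x) y = ψ x y
  eta_anti : StrictAntiOn η (Set.Icc 0 Λ)

/-- A solitary wave (relative to the critical value `sc = s_c` of `γ`): the solution is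
even in `x`, the profile is strictly decreasing on `(0, ∞)` and non-constant, and the
flow converges to a supercritical laminar flow `(U(·; s), d(s))` with `s > s_c`,
`R(s) = r` as `|x| → ∞`.  The crest is at `x = 0`, `η̂ = η 0` and `η̌ = inf η = d(s)`. -/
structure SolitaryWave (γ sc : ℝ) (ψ : ℝ → ℝ → ℝ) (η : ℝ → ℝ) (r : ℝ) : Prop where
  sol : StreamSolution γ ψ η r
  eta_even : ∀ x, η (-x) = η x
  psi_even : ∀ x y, ψ (-x) y = ψ x y
  eta_anti : StrictAntiOn η (Set.Ioi 0)
  nonconst : ∃ x₁ x₂, η x₁ ≠ η x₂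
  asymptotic : ∃ s, sc < s ∧ bernR γ s = r ∧
    ∀ ε > 0, ∃ X : ℝ, ∀ x : ℝ, X ≤ |x| →
      |η x - lamDepth γ s| ≤ ε ∧
      ∀ y ∈ Set.Icc 0 (η x), |px ψ x y| + |py ψ x y - (γ * y + s)| ≤ ε

/-- Smoothness of a curried function of two variables. -/
def Sm (F : ℝ → ℝ → ℝ) : Prop := ContDiff ℝ (⊤ : ℕ∞) (fun p : ℝ × ℝ => F p.1 p.2)

lemma Sm.hasFDerivAt {F : ℝ → ℝ → ℝ} (h : Sm F) (p : ℝ × ℝ) :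
    HasFDerivAt (fun p : ℝ × ℝ => F p.1 p.2) (fderiv ℝ (fun p : ℝ × ℝ => F p.1 p.2) p) p :=
  (h.differentiable (by simp) p).hasFDerivAt

lemma Sm.px_eq {F : ℝ → ℝ → ℝ} (h : Sm F) (x y : ℝ) :
    HasDerivAt (fun t => F t y) (fderiv ℝ (fun p : ℝ × ℝ => F p.1 p.2) (x, y) (1, 0)) x := by
  have h1 : HasDerivAt (fun t : ℝ => (t, y)) ((1 : ℝ), (0 : ℝ)) x :=
    (hasDerivAt_id x).prodMk (hasDerivAt_const x y)
  exact (h.hasFDerivAt (x, y)).comp_hasDerivAt x h1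

lemma Sm.py_eq {F : ℝ → ℝ → ℝ} (h : Sm F) (x y : ℝ) :
    HasDerivAt (fun t => F x t) (fderiv ℝ (fun p : ℝ × ℝ => F p.1 p.2) (x, y) (0, 1)) y := by
  have h1 : HasDerivAt (fun t : ℝ => (x, t)) ((0 : ℝ), (1 : ℝ)) y :=
    (hasDerivAt_const y x).prodMk (hasDerivAt_id y)
  exact (h.hasFDerivAt (x, y)).comp_hasDerivAt y h1

lemma Sm.hdx {F : ℝ → ℝ → ℝ} (h : Sm F) (x y : ℝ) :
    HasDerivAt (fun t => F t y) (px F x y) x := by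
  have := h.px_eq x y
  rw [px, this.deriv]; exact this

lemma Sm.hdy {F : ℝ → ℝ → ℝ} (h : Sm F) (x y : ℝ) :
    HasDerivAt (fun t => F x t) (py F x y) y := by
  have := h.py_eq x y
  rw [py, this.deriv]; exact this

lemma Sm.px_fd {F : ℝ → ℝ → ℝ} (h : Sm F) (x y : ℝ) :
    px F x y = fderiv ℝ (fun p : ℝ × ℝ => F p.1 p.2) (x, y) (1, 0) := (h.px_eq x y).deriv

lemma Sm.py_fd {F : ℝ → ℝ → ℝ} (h : Sm F) (x y : ℝ) :
    py F x y = fderiv ℝ (fun p : ℝ × ℝ => F p.1 p.2) (x, y) (0, 1) := (h.py_eq x y).deriv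

lemma Sm.px {F : ℝ → ℝ → ℝ} (h : Sm F) : Sm (px F) := by
  have h1 : ContDiff ℝ (⊤ : ℕ∞) (fderiv ℝ (fun p : ℝ × ℝ => F p.1 p.2)) :=
    ContDiff.fderiv_right h (by exact le_rfl)
  have h2 : (fun p : ℝ × ℝ => _root_.px F p.1 p.2) =
      fun p => fderiv ℝ (fun p : ℝ × ℝ => F p.1 p.2) p (1, 0) := by
    ext p; exact h.px_fd p.1 p.2
  unfold Sm
  rw [h2]
  exact h1.clm_apply contDiff_const

lemma Sm.py {F : ℝ → ℝ → ℝ} (h : Sm F) : Sm (py F) := by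
  have h1 : ContDiff ℝ (⊤ : ℕ∞) (fderiv ℝ (fun p : ℝ × ℝ => F p.1 p.2)) :=
    ContDiff.fderiv_right h (by exact le_rfl)
  have h2 : (fun p : ℝ × ℝ => _root_.py F p.1 p.2) =
      fun p => fderiv ℝ (fun p : ℝ × ℝ => F p.1 p.2) p (0, 1) := by
    ext p; exact h.py_fd p.1 p.2
  unfold Sm
  rw [h2]
  exact h1.clm_apply contDiff_const

lemma Sm.continuous {F : ℝ → ℝ → ℝ} (h : Sm F) : Continuous (fun p : ℝ × ℝ => F p.1 p.2) :=
  ContDiff.continuous h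

lemma Sm.chain {F : ℝ → ℝ → ℝ} (h : Sm F) {u v : ℝ → ℝ} {u' v' t : ℝ}
    (hu : HasDerivAt u u' t) (hv : HasDerivAt v v' t) :
    HasDerivAt (fun t => F (u t) (v t))
      (_root_.px F (u t) (v t) * u' + _root_.py F (u t) (v t) * v') t := by
  have h1 : HasDerivAt (fun t : ℝ => (u t, v t)) (u', v') t := hu.prodMk hv
  have h2 := (h.hasFDerivAt (u t, v t)).comp_hasDerivAt t h1
  refine h2.congr_deriv ?_
  rw [h.px_fd, h.py_fd]
  have : ((u', v') : ℝ × ℝ) = u' • ((1 : ℝ), (0 : ℝ)) + v' • ((0 : ℝ), (1 : ℝ)) := by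
    ext <;> simp
  rw [this, map_add, map_smul, map_smul]
  simp only [smul_eq_mul]; ring

lemma Sm.px_py {F : ℝ → ℝ → ℝ} (h : Sm F) (x y : ℝ) :
    _root_.px (_root_.py F) x y = _root_.py (_root_.px F) x y := by
  have hsym : IsSymmSndFDerivAt ℝ (fun p : ℝ × ℝ => F p.1 p.2) (x, y) := by
    apply ContDiffAt.isSymmSndFDerivAt (n := (⊤ : ℕ∞)) h.contDiffAt
    simp only [minSmoothness_of_isRCLikeNormedField]
    exact WithTop.coe_le_coe.2 le_top
  have h1 : ContDiff ℝ (⊤ : ℕ∞) (fderiv ℝ (fun p : ℝ × ℝ => F p.1 p.2)) :=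
    ContDiff.fderiv_right h (by exact le_rfl)
  have hd : HasFDerivAt (fderiv ℝ (fun p : ℝ × ℝ => F p.1 p.2))
      (fderiv ℝ (fderiv ℝ (fun p : ℝ × ℝ => F p.1 p.2)) (x, y)) (x, y) :=
    (h1.differentiable (by simp) _).hasFDerivAt
  have e1 : (fun p : ℝ × ℝ => _root_.px F p.1 p.2) =
      fun p => fderiv ℝ (fun p : ℝ × ℝ => F p.1 p.2) p (1, 0) := by
    ext p; exact h.px_fd p.1 p.2
  have e2 : (fun p : ℝ × ℝ => _root_.py F p.1 p.2) =
      fun p => fderiv ℝ (fun p : ℝ × ℝ => F p.1 p.2) p (0, 1) := by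
    ext p; exact h.py_fd p.1 p.2
  rw [h.py.px_fd, h.px.py_fd, e1, e2]
  have a1 := (hd.clm_apply (hasFDerivAt_const ((0 : ℝ), (1 : ℝ)) (x, y))).fderiv
  have a2 := (hd.clm_apply (hasFDerivAt_const ((1 : ℝ), (0 : ℝ)) (x, y))).fderiv
  rw [a1, a2]
  simp
  exact hsym (1, 0) (0, 1)

lemma Sm.add {F G : ℝ → ℝ → ℝ} (hF : Sm F) (hG : Sm G) : Sm (fun x y => F x y + G x y) :=
  ContDiff.add hF hG
lemma Sm.sub {F G : ℝ → ℝ → ℝ} (hF : Sm F) (hG : Sm G) : Sm (fun x y => F x y - G x y) :=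
  ContDiff.sub hF hG
lemma Sm.mul {F G : ℝ → ℝ → ℝ} (hF : Sm F) (hG : Sm G) : Sm (fun x y => F x y * G x y) :=
  ContDiff.mul hF hG
lemma Sm.const (c : ℝ) : Sm (fun _ _ => c) := contDiff_const
lemma Sm.snd : Sm (fun _ y => y) := contDiff_snd

lemma px_add {F G : ℝ → ℝ → ℝ} (hF : Sm F) (hG : Sm G) :
    px (fun x y => F x y + G x y) = fun x y => px F x y + px G x y := by
  ext x y; exact ((hF.hdx x y).add (hG.hdx x y)).deriv
lemma px_sub {F G : ℝ → ℝ → ℝ} (hF : Sm F) (hG : Sm G) :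
    px (fun x y => F x y - G x y) = fun x y => px F x y - px G x y := by
  ext x y; exact ((hF.hdx x y).sub (hG.hdx x y)).deriv
lemma px_mul {F G : ℝ → ℝ → ℝ} (hF : Sm F) (hG : Sm G) :
    px (fun x y => F x y * G x y) = fun x y => px F x y * G x y + F x y * px G x y := by
  ext x y; exact ((hF.hdx x y).mul (hG.hdx x y)).deriv
lemma px_const (c : ℝ) : px (fun _ _ => c) = fun _ _ => 0 := by
  ext x y; exact (hasDerivAt_const x c).deriv
lemma px_snd : px (fun _ y => y) = fun _ _ => 0 := by
  ext x y; exact (hasDerivAt_const x y).deriv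
lemma py_add {F G : ℝ → ℝ → ℝ} (hF : Sm F) (hG : Sm G) :
    py (fun x y => F x y + G x y) = fun x y => py F x y + py G x y := by
  ext x y; exact ((hF.hdy x y).add (hG.hdy x y)).deriv
lemma py_sub {F G : ℝ → ℝ → ℝ} (hF : Sm F) (hG : Sm G) :
    py (fun x y => F x y - G x y) = fun x y => py F x y - py G x y := by
  ext x y; exact ((hF.hdy x y).sub (hG.hdy x y)).deriv
lemma py_mul {F G : ℝ → ℝ → ℝ} (hF : Sm F) (hG : Sm G) :
    py (fun x y => F x y * G x y) = fun x y => py F x y * G x y + F x y * py G x y := by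
  ext x y; exact ((hF.hdy x y).mul (hG.hdy x y)).deriv
lemma py_const (c : ℝ) : py (fun _ _ => c) = fun _ _ => 0 := by
  ext x y; exact (hasDerivAt_const y c).deriv
lemma py_snd : py (fun _ y => y) = fun _ _ => 1 := by
  ext x y; exact (hasDerivAt_id y).deriv

lemma pxx_eq (F : ℝ → ℝ → ℝ) : pxx F = px (px F) := rfl
lemma pyy_eq (F : ℝ → ℝ → ℝ) : pyy F = py (py F) := rfl

/-- Laplacian. -/
def lap (F : ℝ → ℝ → ℝ) (x y : ℝ) : ℝ := pxx F x y + pyy F x y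

/-- One-dimensional second order necessary condition. -/
lemma deriv2_nonneg {f : ℝ → ℝ} (hf : Continuous f) {x : ℝ} (hm : IsLocalMin f x) :
    0 ≤ deriv (deriv f) x := by
  by_contra! hneg
  have h0 : deriv f x = 0 := hm.deriv_eq_zero
  have hmax : IsLocalMax f x := isLocalMax_of_deriv_deriv_neg hneg h0 hf.continuousAt
  have hc : f =ᶠ[nhds x] fun _ => f x := by
    filter_upwards [hm, hmax] with y h1 h2
    exact le_antisymm h2 h1
  have : deriv (deriv f) x = 0 := by
    rw [hc.deriv.deriv_eq]
    simp
  linarith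

lemma min_cond {F : ℝ → ℝ → ℝ} (hF : Sm F) {x y : ℝ}
    (hm : ∀ᶠ p : ℝ × ℝ in nhds (x, y), F x y ≤ F p.1 p.2) :
    px F x y = 0 ∧ py F x y = 0 ∧ 0 ≤ lap F x y := by
  have cx : Continuous (fun t : ℝ => (t, y)) := by fun_prop
  have cy : Continuous (fun t : ℝ => (x, t)) := by fun_prop
  have hx : IsLocalMin (fun t => F t y) x := (cx.tendsto x).eventually hm
  have hy : IsLocalMin (fun t => F x t) y := (cy.tendsto y).eventually hm
  refine ⟨hx.deriv_eq_zero, hy.deriv_eq_zero, ?_⟩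
  have h1 := deriv2_nonneg (hF.continuous.comp cx) hx
  have h2 := deriv2_nonneg (hF.continuous.comp cy) hy
  exact add_nonneg h1 h2

/-- Existence of minimizers on closed periodic sets of bounded height. -/
lemma exists_min {F : ℝ → ℝ → ℝ} (hF : Sm F) {T M : ℝ} (hT : 0 < T)
    (hper : ∀ x y, F (x + T) y = F x y) (C : Set (ℝ × ℝ)) (hC : IsClosed C)
    (hCper : ∀ x y, (x + T, y) ∈ C ↔ (x, y) ∈ C)
    (hCb : ∀ p ∈ C, 0 ≤ p.2 ∧ p.2 ≤ M) (hne : C.Nonempty) :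
    ∃ x y, (x, y) ∈ C ∧ ∀ x' y', (x', y') ∈ C → F x y ≤ F x' y' := by
  have key : ∀ x y, ∃ x' ∈ Icc 0 T, F x' y = F x y ∧ ((x', y) ∈ C ↔ (x, y) ∈ C) := by
    intro x y
    have hp : Function.Periodic (fun x => (F x y, (x, y) ∈ C)) T := by
      intro t
      simp only [Prod.mk.injEq]
      exact ⟨hper t y, propext (hCper t y)⟩
    obtain ⟨x', hx', he⟩ := hp.exists_mem_Ico₀ hT x
    simp only [Prod.mk.injEq] at he
    exact ⟨x', ⟨hx'.1, hx'.2.le⟩, he.1.symm, iff_of_eq he.2.symm⟩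
  have hK : IsCompact (C ∩ (Icc 0 T ×ˢ Icc 0 M)) :=
    (isCompact_Icc.prod isCompact_Icc).inter_left hC
  have hKne : (C ∩ (Icc 0 T ×ˢ Icc 0 M)).Nonempty := by
    obtain ⟨⟨x, y⟩, hp⟩ := hne
    obtain ⟨x', hx', -, h⟩ := key x y
    exact ⟨(x', y), h.2 hp, hx', hCb (x, y) hp⟩
  obtain ⟨⟨x, y⟩, hp, hmin⟩ := hK.exists_isMinOn hKne hF.continuous.continuousOn
  refine ⟨x, y, hp.1, fun x' y' h' => ?_⟩
  obtain ⟨x'', hx'', he, h⟩ := key x' y'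
  rw [← he]
  exact hmin (show (x'', y') ∈ _ from ⟨h.2 h', hx'', hCb (x', y') h'⟩)

lemma eventually_dom {η : ℝ → ℝ} (hη : Continuous η) {x y : ℝ} (h0 : 0 < y) (h1 : y < η x) :
    ∀ᶠ p : ℝ × ℝ in nhds (x, y), 0 < p.2 ∧ p.2 < η p.1 := by
  have a : IsOpen {p : ℝ × ℝ | 0 < p.2 ∧ p.2 < η p.1} :=
    (isOpen_lt continuous_const continuous_snd).inter
      (isOpen_lt continuous_snd (hη.comp continuous_fst))
  exact a.mem_nhds ⟨h0, h1⟩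

lemma closed_dom {η : ℝ → ℝ} (hη : Continuous η) :
    IsClosed {p : ℝ × ℝ | 0 ≤ p.2 ∧ p.2 ≤ η p.1} :=
  (isClosed_le continuous_const continuous_snd).inter
    (isClosed_le continuous_snd (hη.comp continuous_fst))

/-- Minimum principle on the periodic fluid domain. -/
lemma min_principle {F : ℝ → ℝ → ℝ} (hF : Sm F) {η : ℝ → ℝ} (hη : Continuous η) {T M : ℝ}
    (hT : 0 < T) (hper : ∀ x y, F (x + T) y = F x y) (hηper : ∀ x, η (x + T) = η x)
    (hηM : ∀ x, η x ≤ M) (hlap : ∀ x y, 0 < y → y < η x → lap F x y ≤ 0)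
    (htop : ∀ x, 0 ≤ η x → 0 ≤ F x (η x)) (hbot : ∀ x, 0 ≤ F x 0) :
    ∀ x y, 0 ≤ y → y ≤ η x → 0 ≤ F x y := by
  intro x y hy0 hy1
  have key : ∀ ε > 0, -(ε * M ^ 2) ≤ F x y := by
    intro ε hε
    set G : ℝ → ℝ → ℝ := fun x y => F x y - ε * (y * y) with hG
    have hGs : Sm G := hF.sub ((Sm.const ε).mul (Sm.snd.mul Sm.snd))
    obtain ⟨a, b, hab, hmin⟩ := exists_min hGs hT (M := M) (fun x y => by simp [hG, hper])
      {p : ℝ × ℝ | 0 ≤ p.2 ∧ p.2 ≤ η p.1} (closed_dom hη) (fun x y => by simp [hηper])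
      (fun p hp => ⟨hp.1, hp.2.trans (hηM _)⟩) ⟨(x, y), hy0, hy1⟩
    obtain ⟨hb0, hb1⟩ := hab
    simp only at hb0 hb1
    have h1 := hmin x y ⟨hy0, hy1⟩
    have hbM : b ≤ M := hb1.trans (hηM _)
    have hFab : 0 ≤ F a b := by
      rcases hb0.eq_or_lt with h | h
      · rw [← h]; exact hbot a
      rcases hb1.eq_or_lt with h' | h'
      · rw [h']; exact htop a (h' ▸ hb0)
      exfalso
      have hc := (min_cond hGs (x := a) (y := b) (by
        filter_upwards [eventually_dom hη h h'] with p hp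
        exact hmin p.1 p.2 ⟨hp.1.le, hp.2.le⟩)).2.2
      have hl : lap G a b = lap F a b - 2 * ε := by
        simp only [lap, pxx_eq, pyy_eq, hG]
        rw [px_sub hF ((Sm.const ε).mul (Sm.snd.mul Sm.snd)),
          py_sub hF ((Sm.const ε).mul (Sm.snd.mul Sm.snd)),
          px_mul (Sm.const ε) (Sm.snd.mul Sm.snd), py_mul (Sm.const ε) (Sm.snd.mul Sm.snd),
          px_mul Sm.snd Sm.snd, py_mul Sm.snd Sm.snd]
        simp only [px_const, py_const, px_snd, py_snd, zero_mul, mul_zero, add_zero, zero_add,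
          sub_zero, one_mul, mul_one]
        rw [py_sub hF.py ((Sm.const ε).mul (Sm.snd.add Sm.snd)),
          py_mul (Sm.const ε) (Sm.snd.add Sm.snd), py_add Sm.snd Sm.snd]
        simp only [py_const, py_snd]
        ring
      have := hlap a b h h'
      linarith
    have : b * b ≤ M ^ 2 := by nlinarith
    simp only [hG] at h1
    nlinarith [mul_nonneg hε.le (mul_self_nonneg y), mul_le_mul_of_nonneg_left this hε.le]
  by_contra! hneg
  have h2 := key (-F x y / (2 * (M ^ 2 + 1))) (by apply div_pos <;> nlinarith [sq_nonneg M])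
  have h3 : -F x y / (2 * (M ^ 2 + 1)) * M ^ 2 ≤ -F x y / 2 := by
    rw [div_mul_eq_mul_div, div_le_div_iff₀ (by positivity) (by norm_num)]
    nlinarith [sq_nonneg M]
  linarith

lemma Sm.complexContDiff {F : ℝ → ℝ → ℝ} (h : Sm F) :
    ContDiff ℝ (⊤ : ℕ∞) (fun z : ℂ => F z.re z.im) := by
  have h1 : ContDiff ℝ (⊤ : ℕ∞) (fun z : ℂ => (z.re, z.im)) :=
    Complex.reCLM.contDiff.prodMk Complex.imCLM.contDiff
  exact ContDiff.comp h h1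

lemma Sm.complex_fderiv {F : ℝ → ℝ → ℝ} (h : Sm F) (z v : ℂ) :
    fderiv ℝ (fun z : ℂ => F z.re z.im) z v
      = _root_.px F z.re z.im * v.re + _root_.py F z.re z.im * v.im := by
  have h1 : HasFDerivAt (fun z : ℂ => (z.re, z.im)) (Complex.reCLM.prod Complex.imCLM) z :=
    (Complex.reCLM.hasFDerivAt).prodMk (Complex.imCLM.hasFDerivAt)
  have h2 := ((h.hasFDerivAt (z.re, z.im)).comp z h1).fderiv
  have h3 : ((fun p : ℝ × ℝ => F p.1 p.2) ∘ fun z : ℂ => (z.re, z.im))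
    = (fun z : ℂ => F z.re z.im) := rfl
  rw [h3] at h2
  rw [h2, h.px_fd, h.py_fd]
  have : (Complex.reCLM.prod Complex.imCLM) v
      = v.re • ((1 : ℝ), (0 : ℝ)) + v.im • ((0 : ℝ), (1 : ℝ)) := by
    ext <;> simp
  rw [ContinuousLinearMap.comp_apply, this, map_add, map_smul, map_smul]
  simp only [smul_eq_mul]; ring

lemma Sm.complex_laplacian {F : ℝ → ℝ → ℝ} (h : Sm F) (z : ℂ) :
    Laplacian.laplacian (fun z : ℂ => F z.re z.im) z = lap F z.re z.im := by
  rw [InnerProductSpace.laplacian_eq_iteratedFDeriv_complexPlane]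
  simp only [iteratedFDeriv_two_apply]
  have hd : Differentiable ℝ (fderiv ℝ (fun z : ℂ => F z.re z.im)) := by
    have h1 : ContDiff ℝ (⊤ : ℕ∞) (fderiv ℝ (fun z : ℂ => F z.re z.im)) :=
      ContDiff.fderiv_right h.complexContDiff (by exact le_rfl)
    exact h1.differentiable (by simp)
  have key : ∀ v : ℂ, fderiv ℝ (fderiv ℝ (fun z : ℂ => F z.re z.im)) z v v
      = fderiv ℝ (fun w : ℂ => fderiv ℝ (fun z : ℂ => F z.re z.im) w v) z v := by
    intro v
    rw [fderiv_clm_apply (hd z) (differentiableAt_const v)]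
    simp
  simp only [Matrix.cons_val_zero, Matrix.cons_val_one]
  rw [key, key]
  have e1 : (fun w : ℂ => fderiv ℝ (fun z : ℂ => F z.re z.im) w 1)
      = fun w : ℂ => _root_.px F w.re w.im := by
    ext w; rw [h.complex_fderiv]; simp
  have e2 : (fun w : ℂ => fderiv ℝ (fun z : ℂ => F z.re z.im) w Complex.I)
      = fun w : ℂ => _root_.py F w.re w.im := by
    ext w; rw [h.complex_fderiv]; simp
  rw [e1, e2, h.px.complex_fderiv, h.py.complex_fderiv]
  simp [lap, pxx_eq, pyy_eq]

/-- Harnack inequality. -/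
lemma harnack {F : ℝ → ℝ → ℝ} (hF : Sm F) {η : ℝ → ℝ} (hη : Continuous η)
    (hlap : ∀ x y, 0 < y → y < η x → lap F x y = 0)
    (hnn : ∀ x y, 0 < y → y < η x → 0 ≤ F x y) {x0 y0 R : ℝ} (hR : 0 < R)
    (hball : ∀ x y, (x - x0) ^ 2 + (y - y0) ^ 2 ≤ R ^ 2 → 0 < y ∧ y < η x)
    {x y : ℝ} (hxy : (x - x0) ^ 2 + (y - y0) ^ 2 ≤ (R / 2) ^ 2) :
    F x0 y0 / 3 ≤ F x y := by
  set f : ℂ → ℝ := fun z => F z.re z.im with hf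
  set c : ℂ := ⟨x0, y0⟩ with hc
  set w : ℂ := ⟨x, y⟩ with hw
  have hnorm : ∀ z : ℂ, ‖z - c‖ ^ 2 = (z.re - x0) ^ 2 + (z.im - y0) ^ 2 := by
    intro z
    rw [← Complex.normSq_eq_norm_sq, Complex.normSq_apply]
    simp [hc]; ring
  have hin : ∀ z ∈ Metric.closedBall c R, 0 < z.im ∧ z.im < η z.re := by
    intro z hz
    apply hball
    rw [← hnorm]
    rw [mem_closedBall_iff_norm] at hz
    exact pow_le_pow_left₀ (norm_nonneg _) hz 2
  have hharm : InnerProductSpace.HarmonicOnNhd f (Metric.closedBall c R) := by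
    intro z hz
    refine ⟨(hF.complexContDiff.contDiffAt).of_le (WithTop.coe_le_coe.2 le_top), ?_⟩
    have hcont : Continuous (fun z : ℂ => (z.re, z.im)) := by fun_prop
    have := (hcont.tendsto z).eventually (eventually_dom hη (hin z hz).1 (hin z hz).2)
    filter_upwards [this] with u hu
    rw [hF.complex_laplacian, hlap _ _ hu.1 hu.2]; rfl
  have hwc : ‖w - c‖ ≤ R / 2 := by
    apply (sq_le_sq₀ (norm_nonneg _) (by positivity)).1
    rw [hnorm]; exact hxy
  have hwb : w ∈ Metric.ball c R := by
    rw [mem_ball_iff_norm]; linarith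
  have hP := hharm.circleAverage_poissonKernel_smul hwb
  have hM := InnerProductSpace.HarmonicOnNhd.circleAverage_eq (f := f) (c := c) (R := R)
    (by rwa [abs_of_pos hR])
  have hfc : Continuous f := hF.complexContDiff.continuous
  have hk : ContinuousOn (poissonKernel c w) (Metric.sphere c |R|) := by
    rw [poissonKernel_eq_re_herglotzRieszKernel]
    exact Complex.continuous_re.comp_continuousOn (continuousOn_herglotzRieszKernel_sphere hwb)
  have hmono : Real.circleAverage ((1 / 3 : ℝ) • f) c R
      ≤ Real.circleAverage (poissonKernel c w • f) c R := by
    apply Real.circleAverage_mono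
    · exact (ContinuousOn.circleIntegrable' ((hfc.const_smul (1 / 3 : ℝ)).continuousOn))
    · exact (hk.smul hfc.continuousOn).circleIntegrable'
    · intro z hz
      rw [abs_of_pos hR] at hz
      have h1 := le_re_herglotzRieszKernel hz hwb
      have h2 : (1 : ℝ) / 3 ≤ (R - ‖w - c‖) / (R + ‖w - c‖) := by
        rw [div_le_div_iff₀ (by norm_num) (by positivity)]
        linarith
      have h3 : (1 : ℝ) / 3 ≤ poissonKernel c w z := by
        rw [poissonKernel_eq_re_herglotzRieszKernel]
        exact h2.trans h1
      have h4 := hin z (Metric.sphere_subset_closedBall hz)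
      have h5 : 0 ≤ f z := hnn _ _ h4.1 h4.2
      simp only [Pi.smul_apply, Pi.smul_apply', smul_eq_mul]
      exact mul_le_mul_of_nonneg_right h3 h5
  rw [hP, Real.circleAverage_smul, hM] at hmono
  simp only [smul_eq_mul] at hmono
  have e1 : f c = F x0 y0 := rfl
  have e2 : f w = F x y := rfl
  rw [e1, e2] at hmono
  linarith

lemma lap_add {F G : ℝ → ℝ → ℝ} (hF : Sm F) (hG : Sm G) (x y : ℝ) :
    lap (fun x y => F x y + G x y) x y = lap F x y + lap G x y := by
  simp only [lap, pxx_eq, pyy_eq]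
  rw [px_add hF hG, py_add hF hG, px_add hF.px hG.px, py_add hF.py hG.py]; ring

lemma lap_sub {F G : ℝ → ℝ → ℝ} (hF : Sm F) (hG : Sm G) (x y : ℝ) :
    lap (fun x y => F x y - G x y) x y = lap F x y - lap G x y := by
  simp only [lap, pxx_eq, pyy_eq]
  rw [px_sub hF hG, py_sub hF hG, px_sub hF.px hG.px, py_sub hF.py hG.py]; ring

lemma lap_mul {F G : ℝ → ℝ → ℝ} (hF : Sm F) (hG : Sm G) (x y : ℝ) :
    lap (fun x y => F x y * G x y) x y = lap F x y * G x y
      + 2 * (px F x y * px G x y + py F x y * py G x y) + F x y * lap G x y := by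
  simp only [lap, pxx_eq, pyy_eq]
  rw [px_mul hF hG, py_mul hF hG, px_add (hF.px.mul hG) (hF.mul hG.px),
    py_add (hF.py.mul hG) (hF.mul hG.py), px_mul hF.px hG, px_mul hF hG.px,
    py_mul hF.py hG, py_mul hF hG.py]; ring

lemma lap_const (c x y : ℝ) : lap (fun _ _ => c) x y = 0 := by
  simp [lap, pxx_eq, pyy_eq, px_const, py_const]

lemma lap_snd (x y : ℝ) : lap (fun _ y => y) x y = 0 := by
  simp [lap, pxx_eq, pyy_eq, px_snd, py_snd, px_const, py_const]

lemma lap_cmul {F : ℝ → ℝ → ℝ} (c : ℝ) (hF : Sm F) (x y : ℝ) :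
    lap (fun x y => c * F x y) x y = c * lap F x y := by
  rw [lap_mul (Sm.const c) hF, lap_const, px_const, py_const]; ring

/-- Rescaled flow: unit vorticity, small gravity `g`. -/
structure WFlow (δ g T c : ℝ) (ψ : ℝ → ℝ → ℝ) (η : ℝ → ℝ) : Prop where
  hψ : Sm ψ
  hη : ContDiff ℝ (⊤ : ℕ∞) η
  hT : 0 < T
  hg : 0 < g
  hδ : 1 ≤ δ
  ηper : ∀ x, η (x + T) = η x
  ηeven : ∀ x, η (-x) = η x
  ψper : ∀ x y, ψ (x + T) y = ψ x y
  ηpos : ∀ x, 0 < η x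
  ηle : ∀ x, η x ≤ 3 * δ
  lap1 : ∀ x y, 0 < y → y < η x → lap ψ x y = 1
  surf : ∀ x, ψ x (η x) = 1
  bot : ∀ x, ψ x 0 = 0
  uni : ∀ x y, 0 < y → y < η x → 0 < py ψ x y
  bern : ∀ x, px ψ x (η x) ^ 2 + py ψ x (η x) ^ 2 + 2 * g * η x = c
  lo : ∀ x, 3 / 2 ≤ px ψ x (η x) ^ 2 + py ψ x (η x) ^ 2
  hi : ∀ x, px ψ x (η x) ^ 2 + py ψ x (η x) ^ 2 ≤ 4

lemma px_per {F : ℝ → ℝ → ℝ} {T : ℝ} (h : ∀ x y, F (x + T) y = F x y) (x y : ℝ) :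
    px F (x + T) y = px F x y := by
  unfold px
  rw [← deriv_comp_add_const]
  congr 1; ext t; exact h t y

lemma py_per {F : ℝ → ℝ → ℝ} {T : ℝ} (h : ∀ x y, F (x + T) y = F x y) (x y : ℝ) :
    py F (x + T) y = py F x y := by
  unfold py
  congr 1; ext t; exact h x t

lemma Sm.py_px_fun {F : ℝ → ℝ → ℝ} (h : Sm F) :
    _root_.py (_root_.px F) = _root_.px (_root_.py F) := by
  ext x y; exact (h.px_py x y).symm

namespace WFlow

variable {δ g T c : ℝ} {ψ : ℝ → ℝ → ℝ} {η : ℝ → ℝ}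

lemma lap_px (h : WFlow δ g T c ψ η) {x y : ℝ} (h0 : 0 < y) (h1 : y < η x) :
    lap (px ψ) x y = 0 := by
  have e : lap (px ψ) x y = px (lap ψ) x y := by
    have : lap ψ = fun x y => px (px ψ) x y + py (py ψ) x y := rfl
    rw [this, px_add h.hψ.px.px h.hψ.py.py]
    simp only [lap, pxx_eq, pyy_eq]
    rw [h.hψ.py_px_fun, h.hψ.py.py_px_fun]
  rw [e]
  have : (fun t => lap ψ t y) =ᶠ[nhds x] fun _ => 1 := by
    have cx : Continuous (fun t : ℝ => (t, y)) := by fun_prop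
    filter_upwards [(cx.tendsto x).eventually (eventually_dom h.hη.continuous h0 h1)] with t ht
    exact h.lap1 _ _ ht.1 ht.2
  unfold px
  rw [this.deriv_eq]; simp

lemma lap_py (h : WFlow δ g T c ψ η) {x y : ℝ} (h0 : 0 < y) (h1 : y < η x) :
    lap (py ψ) x y = 0 := by
  have e : lap (py ψ) x y = py (lap ψ) x y := by
    have : lap ψ = fun x y => px (px ψ) x y + py (py ψ) x y := rfl
    rw [this, py_add h.hψ.px.px h.hψ.py.py]
    simp only [lap, pxx_eq, pyy_eq]
    rw [h.hψ.px.py_px_fun, h.hψ.py_px_fun]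
  rw [e]
  have : (fun t => lap ψ x t) =ᶠ[nhds y] fun _ => 1 := by
    have cx : Continuous (fun t : ℝ => (x, t)) := by fun_prop
    filter_upwards [(cx.tendsto y).eventually (eventually_dom h.hη.continuous h0 h1)] with t ht
    exact h.lap1 _ _ ht.1 ht.2
  unfold py
  rw [this.deriv_eq]; simp

lemma py_nonneg (h : WFlow δ g T c ψ η) {x y : ℝ} (h0 : 0 ≤ y) (h1 : y ≤ η x) :
    0 ≤ py ψ x y := by
  have hc : IsClosed {t : ℝ | 0 ≤ py ψ x t} :=
    isClosed_le continuous_const (h.hψ.py.continuous.comp (by fun_prop : Continuous fun t : ℝ => (x, t)))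
  have hs : Ioo 0 (η x) ⊆ {t : ℝ | 0 ≤ py ψ x t} := fun t ht => (h.uni x t ht.1 ht.2).le
  have := closure_minimal hs hc
  rw [closure_Ioo (h.ηpos x).ne] at this
  exact this ⟨h0, h1⟩

lemma hdη (h : WFlow δ g T c ψ η) (x : ℝ) : HasDerivAt η (deriv η x) x :=
  (h.hη.differentiable (by simp) x).hasDerivAt

lemma slope (h : WFlow δ g T c ψ η) (x : ℝ) :
    px ψ x (η x) = - deriv η x * py ψ x (η x) := by
  have h1 := h.hψ.chain (hasDerivAt_id x) (h.hdη x)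
  have h2 : (fun t => ψ (id t) (η t)) = fun _ => 1 := by ext t; exact h.surf t
  rw [h2] at h1
  have h3 := h1.unique (hasDerivAt_const x 1)
  simp only [id] at h3
  linarith

lemma py_pos_surf (h : WFlow δ g T c ψ η) (x : ℝ) : 0 < py ψ x (η x) := by
  rcases (h.py_nonneg (h.ηpos x).le le_rfl).eq_or_lt with h0 | h0
  · have h1 := h.slope x
    have h2 := h.lo x
    rw [← h0] at h1 h2
    rw [h1] at h2
    norm_num at h2
  · exact h0

lemma px_bot (h : WFlow δ g T c ψ η) (x : ℝ) : px ψ x 0 = 0 := by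
  unfold px
  have : (fun t => ψ t 0) = fun _ => 0 := by ext t; exact h.bot t
  rw [this]; simp

lemma psi_mono (h : WFlow δ g T c ψ η) (x : ℝ) : MonotoneOn (fun t => ψ x t) (Icc 0 (η x)) := by
  apply monotoneOn_of_deriv_nonneg (convex_Icc _ _)
  · exact fun t _ => (h.hψ.hdy x t).continuousAt.continuousWithinAt
  · exact fun t _ => (h.hψ.hdy x t).differentiableAt.differentiableWithinAt
  · intro t ht
    rw [interior_Icc] at ht
    exact (h.uni x t ht.1 ht.2).le

lemma psi_nonneg (h : WFlow δ g T c ψ η) {x y : ℝ} (h0 : 0 ≤ y) (h1 : y ≤ η x) : 0 ≤ ψ x y := by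
  have := h.psi_mono x ⟨le_rfl, (h.ηpos x).le⟩ ⟨h0, h1⟩ h0
  simpa [h.bot] using this

lemma psi_le_one (h : WFlow δ g T c ψ η) {x y : ℝ} (h0 : 0 ≤ y) (h1 : y ≤ η x) : ψ x y ≤ 1 := by
  have := h.psi_mono x ⟨h0, h1⟩ ⟨(h.ηpos x).le, le_rfl⟩ h1
  simpa [h.surf] using this

/-- `ψ ≤ 2 y`. -/
lemma psi_le (h : WFlow δ g T c ψ η) {x y : ℝ} (h0 : 0 ≤ y) (h1 : y ≤ η x) : ψ x y ≤ 2 * y := by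
  have hsm : Sm (fun x _ => η x) := ContDiff.comp h.hη contDiff_fst
  obtain ⟨a, b, -, hmin⟩ := exists_min hsm (T := T) (M := 0) h.hT (fun x y => h.ηper x)
    {p | p.2 = 0} (isClosed_eq continuous_snd continuous_const) (fun x y => by simp)
    (fun p hp => ⟨le_of_eq hp.symm, le_of_eq hp⟩) ⟨(0, 0), rfl⟩
  have hm : ∀ x, η a ≤ η x := fun x => hmin x 0 rfl
  have hap := h.ηpos a
  set k := (η a)⁻¹ with hk
  have hkp : 0 < k := inv_pos.2 hap
  have hka : k * η a = 1 := inv_mul_cancel₀ hap.ne'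
  have hG : Sm (fun x y => k * y - ψ x y) := ((Sm.const k).mul Sm.snd).sub h.hψ
  have strip : ∀ x y, 0 ≤ y → y ≤ η a → 0 ≤ k * y - ψ x y := by
    refine min_principle hG (η := fun _ => η a) (M := η a) continuous_const h.hT
      (fun x y => by rw [h.ψper]) (fun _ => rfl) (fun _ => le_rfl) ?_ ?_ ?_
    · intro x y hy0 hy1
      rw [lap_sub ((Sm.const k).mul Sm.snd) h.hψ, lap_cmul k Sm.snd, lap_snd,
        h.lap1 x y hy0 (lt_of_lt_of_le hy1 (hm x))]
      norm_num
    · intro x hx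
      rw [hka]
      linarith [h.psi_le_one hx (hm x)]
    · intro x; rw [h.bot]; simp
  have all : ∀ x y, 0 ≤ y → y ≤ η x → ψ x y ≤ k * y := by
    intro x y hy0 hy1
    rcases le_total y (η a) with hle | hle
    · linarith [strip x y hy0 hle]
    · have := h.psi_le_one hy0 hy1
      nlinarith
  have hd0 : deriv η a = 0 := by
    have : IsLocalMin η a := Filter.Eventually.of_forall hm
    exact this.deriv_eq_zero
  have hpx : px ψ a (η a) = 0 := by rw [h.slope, hd0]; ring
  have hpy : py ψ a (η a) ≤ 2 := by
    have := h.hi a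
    rw [hpx] at this
    nlinarith
  have hkle : k ≤ py ψ a (η a) := by
    by_contra! hlt
    have hd : HasDerivAt (fun t => k * t - ψ a t) (k * 1 - py ψ a (η a)) (η a) :=
      ((hasDerivAt_id (η a)).const_mul k).sub (h.hψ.hdy a (η a))
    have hpos : 0 < deriv (fun t => k * t - ψ a t) (η a) := by rw [hd.deriv]; linarith
    have h2 := eventually_nhdsWithin_sign_eq_of_deriv_pos hpos (by rw [hka, h.surf]; ring)
    have h3 : ∀ᶠ t in nhdsWithin (η a) (Iio (η a)), t ∈ Ioo 0 (η a) :=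
      Ioo_mem_nhdsLT hap
    have h4 : nhdsWithin (η a) (Iio (η a)) ≤ nhds (η a) := nhdsWithin_le_nhds
    obtain ⟨t, ht1, ht2⟩ := (h3.and (h4 h2)).exists
    have h5 := strip a t ht1.1.le ht1.2.le
    rw [sign_neg (by linarith [ht1.2] : t - η a < 0)] at ht2
    have := sign_eq_neg_one_iff.1 ht2
    linarith
  have := all x y h0 h1
  nlinarith

lemma py_bot_le (h : WFlow δ g T c ψ η) (x : ℝ) : py ψ x 0 ≤ 2 := by
  by_contra! hlt
  have hd : HasDerivAt (fun t => ψ x t - 2 * t) (py ψ x 0 - 2 * 1) 0 :=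
    (h.hψ.hdy x 0).sub ((hasDerivAt_id (0 : ℝ)).const_mul 2)
  have hpos : 0 < deriv (fun t => ψ x t - 2 * t) 0 := by rw [hd.deriv]; linarith
  have h2 := eventually_nhdsWithin_sign_eq_of_deriv_pos hpos (by rw [h.bot]; ring)
  have h3 : ∀ᶠ t in nhdsWithin 0 (Ioi (0 : ℝ)), t ∈ Ioo 0 (η x) := Ioo_mem_nhdsGT (h.ηpos x)
  have h4 : nhdsWithin 0 (Ioi (0 : ℝ)) ≤ nhds 0 := nhdsWithin_le_nhds
  obtain ⟨t, ht1, ht2⟩ := (h3.and (h4 h2)).exists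
  rw [sign_pos (by linarith [ht1.1] : 0 < t - 0)] at ht2
  have := sign_eq_one_iff.1 ht2
  linarith [h.psi_le ht1.1.le ht1.2.le]

lemma py_le (h : WFlow δ g T c ψ η) {x y : ℝ} (h0 : 0 ≤ y) (h1 : y ≤ η x) : py ψ x y ≤ 2 := by
  have := min_principle (F := fun x y => 2 - py ψ x y) ((Sm.const 2).sub h.hψ.py) h.hη.continuous
    h.hT (fun x y => by rw [py_per h.ψper]) h.ηper h.ηle
    (fun x y h0 h1 => by
      rw [lap_sub (Sm.const 2) h.hψ.py, lap_const, h.lap_py h0 h1]; simp)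
    (fun x _ => by nlinarith [h.hi x, sq_nonneg (px ψ x (η x))])
    (fun x => by linarith [h.py_bot_le x]) x y h0 h1
  linarith

lemma px_le (h : WFlow δ g T c ψ η) {x y : ℝ} (h0 : 0 ≤ y) (h1 : y ≤ η x) : px ψ x y ≤ 2 := by
  have := min_principle (F := fun x y => 2 - px ψ x y) ((Sm.const 2).sub h.hψ.px) h.hη.continuous
    h.hT (fun x y => by rw [px_per h.ψper]) h.ηper h.ηle
    (fun x y h0 h1 => by
      rw [lap_sub (Sm.const 2) h.hψ.px, lap_const, h.lap_px h0 h1]; simp)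
    (fun x _ => by nlinarith [h.hi x, sq_nonneg (py ψ x (η x))])
    (fun x => by rw [h.px_bot x]; norm_num) x y h0 h1
  linarith

lemma le_px (h : WFlow δ g T c ψ η) {x y : ℝ} (h0 : 0 ≤ y) (h1 : y ≤ η x) : -2 ≤ px ψ x y := by
  have := min_principle (F := fun x y => 2 + px ψ x y) ((Sm.const 2).add h.hψ.px) h.hη.continuous
    h.hT (fun x y => by rw [px_per h.ψper]) h.ηper h.ηle
    (fun x y h0 h1 => by
      rw [lap_add (Sm.const 2) h.hψ.px, lap_const, h.lap_px h0 h1]; simp)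
    (fun x _ => by nlinarith [h.hi x, sq_nonneg (py ψ x (η x))])
    (fun x => by rw [h.px_bot x]; norm_num) x y h0 h1
  linarith

/-- The `P`-function estimate `|∇ψ|² ≥ (3/2) ψ`. -/
lemma grad_lower (h : WFlow δ g T c ψ η) {x y : ℝ} (h0 : 0 ≤ y) (h1 : y ≤ η x) :
    3 / 2 * ψ x y ≤ px ψ x y ^ 2 + py ψ x y ^ 2 := by
  have hX := h.hψ.px
  have hY := h.hψ.py
  set Q : ℝ → ℝ → ℝ := fun x y => (px ψ x y * px ψ x y + py ψ x y * py ψ x y) - 3 / 2 * ψ x y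
    with hQ
  have hQs : Sm Q := ((hX.mul hX).add (hY.mul hY)).sub ((Sm.const _).mul h.hψ)
  obtain ⟨a, b, hab, hmin⟩ := exists_min hQs h.hT (M := 3 * δ)
    (fun x y => by simp only [hQ]; rw [px_per h.ψper, py_per h.ψper, h.ψper])
    {p : ℝ × ℝ | 0 ≤ p.2 ∧ p.2 ≤ η p.1} (closed_dom h.hη.continuous) (fun x y => by simp [h.ηper])
    (fun p hp => ⟨hp.1, hp.2.trans (h.ηle _)⟩) ⟨(x, y), h0, h1⟩
  obtain ⟨hb0, hb1⟩ := hab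
  simp only at hb0 hb1
  have hle := hmin x y ⟨h0, h1⟩
  have hQab : 0 ≤ Q a b := by
    rcases hb0.eq_or_lt with hb | hb
    · rw [← hb]; simp only [hQ]; rw [h.bot]; nlinarith [sq_nonneg (px ψ a 0), sq_nonneg (py ψ a 0)]
    rcases hb1.eq_or_lt with hb' | hb'
    · rw [hb']; simp only [hQ]; rw [h.surf]; nlinarith [h.lo a]
    exfalso
    obtain ⟨m1, m2, m3⟩ := min_cond hQs (x := a) (y := b) (by
        filter_upwards [eventually_dom h.hη.continuous hb hb'] with p hp
        exact hmin p.1 p.2 ⟨hp.1.le, hp.2.le⟩)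
    have e1 : px Q a b = 2 * (px ψ a b * px (px ψ) a b + py ψ a b * px (py ψ) a b)
        - 3 / 2 * px ψ a b := by
      simp only [hQ]
      rw [px_sub ((hX.mul hX).add (hY.mul hY)) ((Sm.const _).mul h.hψ),
        px_add (hX.mul hX) (hY.mul hY), px_mul hX hX, px_mul hY hY, px_mul (Sm.const _) h.hψ,
        px_const]
      ring
    have e2 : py Q a b = 2 * (px ψ a b * px (py ψ) a b + py ψ a b * py (py ψ) a b)
        - 3 / 2 * py ψ a b := by
      simp only [hQ]
      rw [py_sub ((hX.mul hX).add (hY.mul hY)) ((Sm.const _).mul h.hψ),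
        py_add (hX.mul hX) (hY.mul hY), py_mul hX hX, py_mul hY hY, py_mul (Sm.const _) h.hψ,
        py_const, h.hψ.py_px_fun]
      ring
    have e3 : lap Q a b = 2 * (px (px ψ) a b ^ 2 + 2 * px (py ψ) a b ^ 2 + py (py ψ) a b ^ 2)
        - 3 / 2 := by
      simp only [hQ]
      rw [lap_sub ((hX.mul hX).add (hY.mul hY)) ((Sm.const _).mul h.hψ),
        lap_add (hX.mul hX) (hY.mul hY), lap_mul hX hX, lap_mul hY hY, lap_cmul _ h.hψ,
        h.lap_px hb hb', h.lap_py hb hb', h.lap1 a b hb hb', h.hψ.py_px_fun]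
      ring
    have e4 : px (px ψ) a b + py (py ψ) a b = 1 := h.lap1 a b hb hb'
    have hpos := h.uni a b hb hb'
    rw [e1] at m1
    rw [e2] at m2
    rw [e3] at m3
    generalize px (px ψ) a b = A at *
    generalize px (py ψ) a b = B at *
    generalize py (py ψ) a b = C at *
    generalize px ψ a b = u at *
    generalize py ψ a b = v at *
    have hdet : (A - 3 / 4) * (C - 3 / 4) - B ^ 2 = 0 := by
      have : v * ((A - 3 / 4) * (C - 3 / 4) - B ^ 2) = 0 := by
        linear_combination (A - 3 / 4) / 2 * m2 - B / 2 * m1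
      rcases mul_eq_zero.1 this with h' | h'
      · exact absurd h' hpos.ne'
      · exact h'
    have hC : C = 1 - A := by linarith
    subst hC
    nlinarith
  have : 0 ≤ Q x y := hQab.trans hle
  simp only [hQ] at this
  nlinarith

end WFlow

/-- The directional derivative `ψ_y - a ψ_x`. -/
def W (a : ℝ) (ψ : ℝ → ℝ → ℝ) (x y : ℝ) : ℝ := py ψ x y - a * px ψ x y

namespace WFlow

variable {δ g T c a : ℝ} {ψ : ℝ → ℝ → ℝ} {η : ℝ → ℝ}

lemma W_sm (h : WFlow δ g T c ψ η) : Sm (W a ψ) :=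
  h.hψ.py.sub ((Sm.const a).mul h.hψ.px)

lemma W_per (h : WFlow δ g T c ψ η) (x y : ℝ) : W a ψ (x + T) y = W a ψ x y := by
  unfold W; rw [py_per h.ψper, px_per h.ψper]

lemma W_lap (h : WFlow δ g T c ψ η) {x y : ℝ} (h0 : 0 < y) (h1 : y < η x) :
    lap (W a ψ) x y = 0 := by
  have : W a ψ = fun x y => py ψ x y - a * px ψ x y := rfl
  rw [this, lap_sub h.hψ.py ((Sm.const a).mul h.hψ.px), lap_cmul a h.hψ.px, h.lap_px h0 h1,
    h.lap_py h0 h1]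
  ring

lemma W_surf (h : WFlow δ g T c ψ η) (x : ℝ) :
    W a ψ x (η x) = py ψ x (η x) * (1 + a * deriv η x) := by
  unfold W; rw [h.slope]; ring

lemma W_nonneg (h : WFlow δ g T c ψ η) (has : ∀ x, 0 ≤ 1 + a * deriv η x) {x y : ℝ}
    (h0 : 0 ≤ y) (h1 : y ≤ η x) : 0 ≤ W a ψ x y := by
  refine min_principle h.W_sm h.hη.continuous h.hT h.W_per h.ηper h.ηle
    (fun x y h0 h1 => (h.W_lap h0 h1).le) ?_ ?_ x y h0 h1
  · intro x _
    rw [h.W_surf]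
    exact mul_nonneg (h.py_pos_surf x).le (has x)
  · intro x
    unfold W
    rw [h.px_bot]
    have := h.py_nonneg (x := x) le_rfl (h.ηpos x).le
    linarith

lemma ball_in (h : WFlow δ g T c ψ η) {x y : ℝ} (h0 : 0 ≤ y) (h1 : y ≤ η x)
    (hl : 1 / 4 ≤ ψ x y) (hu : ψ x y ≤ 1 / 2) {x' y' : ℝ}
    (hd : (x' - x) ^ 2 + (y' - y) ^ 2 ≤ (1 / 32) ^ 2) : 0 < y' ∧ y' < η x' := by
  have hy8 : 1 / 8 ≤ y := by linarith [h.psi_le h0 h1]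
  have hdx := abs_le_of_sq_le_sq' (by nlinarith [sq_nonneg (y' - y)] :
    (x' - x) ^ 2 ≤ (1 / 32) ^ 2) (by norm_num)
  have hdy := abs_le_of_sq_le_sq' (by nlinarith [sq_nonneg (x' - x)] :
    (y' - y) ^ 2 ≤ (1 / 32) ^ 2) (by norm_num)
  refine ⟨by linarith [hdy.1], ?_⟩
  by_contra! hcon
  set u : ℝ → ℝ := fun t => x + t * (x' - x) with hu'
  set v : ℝ → ℝ := fun t => y + t * (y' - y) with hv'
  have cf : Continuous (fun t => η (u t) - v t) :=
    (h.hη.continuous.comp (by fun_prop)).sub (by fun_prop)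
  have hK : IsCompact (Icc (0 : ℝ) 1 ∩ {t | η (u t) - v t ≤ 0}) :=
    isCompact_Icc.inter_right (isClosed_le cf continuous_const)
  obtain ⟨t0, ⟨ht0, ht0'⟩, hmin⟩ := hK.exists_isLeast ⟨1, ⟨by simp, by
    simp only [hu', hv', mem_ofPred_eq]
    rw [show x + 1 * (x' - x) = x' by ring]; linarith⟩⟩
  have hz : η (u t0) - v t0 = 0 := by
    have := intermediate_value_Icc' ht0.1 cf.continuousOn
    obtain ⟨s, hs, hs'⟩ := this ⟨ht0', by simp [hu', hv', h1]⟩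
    have hs'' : s = t0 := le_antisymm hs.2 (hmin ⟨⟨hs.1, hs.2.trans ht0.2⟩, le_of_eq hs'⟩)
    rw [← hs'']; exact hs'
  have h1' : ψ (u t0) (v t0) = 1 := by
    rw [show v t0 = η (u t0) by linarith]; exact h.surf _
  have h0' : ψ (u 0) (v 0) ≤ 1 / 2 := by simpa [hu', hv'] using hu
  have hpos : 0 < t0 := by
    rcases ht0.1.eq_or_lt with e | e
    · rw [← e] at h1'; linarith
    · exact e
  have hder : ∀ t, HasDerivAt (fun t => ψ (u t) (v t))
      (px ψ (u t) (v t) * (x' - x) + py ψ (u t) (v t) * (y' - y)) t := by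
    intro t
    refine h.hψ.chain ?_ ?_
    · exact (((hasDerivAt_id t).mul_const (x' - x)).const_add x).congr_deriv (one_mul _)
    · exact (((hasDerivAt_id t).mul_const (y' - y)).const_add y).congr_deriv (one_mul _)
  obtain ⟨s, hs, hs'⟩ := exists_hasDerivAt_eq_slope (fun t => ψ (u t) (v t)) _ hpos
    (fun t _ => (hder t).continuousAt.continuousWithinAt) (fun t _ => hder t)
  have hin : v s ≤ η (u s) := by
    by_contra! hlt
    have := hmin ⟨⟨hs.1.le, hs.2.le.trans ht0.2⟩, (by simp only [mem_ofPred_eq]; linarith)⟩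
    linarith [hs.2]
  have hvs : 0 ≤ v s := by
    simp only [hv']
    nlinarith [hs.1, hs.2, ht0.2, hdy.1]
  have b1 := h.px_le hvs hin
  have b2 := h.le_px hvs hin
  have b3 := h.py_le hvs hin
  have b4 := h.py_nonneg hvs hin
  rw [eq_div_iff (by linarith)] at hs'
  have c1 : px ψ (u s) (v s) * (x' - x) ≤ 1 / 16 := by
    have := abs_mul (px ψ (u s) (v s)) (x' - x)
    have e1 : |px ψ (u s) (v s)| ≤ 2 := abs_le.2 ⟨b2, b1⟩
    have e2 : |x' - x| ≤ 1 / 32 := abs_le.2 hdx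
    have := mul_le_mul e1 e2 (abs_nonneg _) (by norm_num)
    rw [← abs_mul] at this
    linarith [le_abs_self (px ψ (u s) (v s) * (x' - x))]
  have c2 : py ψ (u s) (v s) * (y' - y) ≤ 1 / 16 := by nlinarith [hdy.2]
  have := ht0.2
  nlinarith

lemma level_lower (h : WFlow δ g T c ψ η) (ha0 : 0 < a) (ha1 : a ≤ 1)
    (has : ∀ x, 0 ≤ 1 + a * deriv η x) {x y : ℝ} (h0 : 0 ≤ y) (h1 : y ≤ η x)
    (hl : ψ x y = 1 / 2) : (1 / 3 : ℝ) ^ ⌈384 * δ⌉₊ * (1 / (12 * δ)) ≤ W a ψ x y := by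
  have hδ := h.hδ
  set u : ℝ → ℝ := fun s => x + a * (y - s) with hu
  have hud : ∀ s, HasDerivAt u (-a) s := by
    intro s
    exact ((((hasDerivAt_id s).const_sub y).const_mul a).const_add x).congr_deriv (by ring)
  have huy : u y = x := by simp [hu]
  have hanti : Antitone (fun s => η (u s) - s) := by
    have hd : ∀ s, HasDerivAt (fun s => η (u s) - s) (deriv η (u s) * (-a) - 1) s := fun s =>
      ((h.hdη (u s)).comp s (hud s)).sub (hasDerivAt_id s)
    apply antitone_of_deriv_nonpos (fun s => (hd s).differentiableAt)
    intro s
    rw [(hd s).deriv]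
    linarith [has (u s)]
  have hin : ∀ s, s ≤ y → s ≤ η (u s) := by
    intro s hs
    have := hanti hs
    simp only [huy] at this
    linarith
  set φ : ℝ → ℝ := fun s => ψ (u s) s with hφ
  have hφd : ∀ s, HasDerivAt φ (W a ψ (u s) s) s := by
    intro s
    have := h.hψ.chain (hud s) (hasDerivAt_id s)
    refine this.congr_deriv ?_
    simp only [W, id]; ring
  have hφc : Continuous φ := continuous_iff_continuousAt.2 fun s => (hφd s).continuousAt
  have hmono : MonotoneOn φ (Icc 0 y) := by
    apply monotoneOn_of_deriv_nonneg (convex_Icc _ _) hφc.continuousOn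
    · exact fun s _ => (hφd s).differentiableAt.differentiableWithinAt
    · intro s hs
      rw [interior_Icc] at hs
      rw [(hφd s).deriv]
      exact h.W_nonneg has hs.1.le (hin s hs.2.le)
  have φ0 : φ 0 = 0 := h.bot _
  have φy : φ y = 1 / 2 := by simp only [hφ, huy, hl]
  obtain ⟨s1, hs1, hs1'⟩ := intermediate_value_Icc h0 hφc.continuousOn
    (show (1 / 4 : ℝ) ∈ Icc (φ 0) (φ y) by rw [φ0, φy]; norm_num)
  have hs1y : s1 < y := by
    rcases hs1.2.eq_or_lt with e | e
    · rw [e, φy] at hs1'; norm_num at hs1'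
    · exact e
  obtain ⟨s2, hs2, hs2'⟩ := exists_hasDerivAt_eq_slope φ _ hs1y hφc.continuousOn
    (fun t _ => hφd t)
  have hy3 : y ≤ 3 * δ := h1.trans (h.ηle x)
  have hW2 : 1 / (12 * δ) ≤ W a ψ (u s2) s2 := by
    rw [hs2', φy, hs1', div_le_div_iff₀ (by linarith) (by linarith)]
    linarith [hs1.1]
  have hrange : ∀ s, s2 ≤ s → s ≤ y → 1 / 4 ≤ ψ (u s) s ∧ ψ (u s) s ≤ 1 / 2 := by
    intro s hs hs'
    have hs0 : s ∈ Icc 0 y := ⟨by linarith [hs1.1, hs2.1], hs'⟩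
    constructor
    · have := hmono hs1 hs0 (by linarith [hs2.1]); rw [hs1'] at this; exact this
    · have := hmono hs0 ⟨h0, le_rfl⟩ hs'; rw [φy] at this; exact this
  have s2pos : 0 ≤ s2 := by linarith [hs1.1, hs2.1]
  have chain : ∀ n : ℕ, ∀ s, s2 ≤ s → s ≤ y → s - s2 ≤ n / 128 →
      (1 / 3 : ℝ) ^ n * (1 / (12 * δ)) ≤ W a ψ (u s) s := by
    intro n
    induction n with
    | zero =>
      intro s hs hs' hd
      have : s = s2 := by
        simp at hd; linarith
      rw [this]; simpa using hW2
    | succ n ih =>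
      intro s hs hs' hd
      push_cast at hd
      set s' := max s2 (s - 1 / 128) with hs'def
      have e1 : s2 ≤ s' := le_max_left _ _
      have e2 : s' ≤ s := max_le hs (by linarith)
      have e3 : s - 1 / 128 ≤ s' := le_max_right _ _
      have e4 : s' - s2 ≤ n / 128 := by
        have : (0 : ℝ) ≤ n / 128 := by positivity
        have : s' ≤ s2 + n / 128 := max_le (by linarith) (by linarith)
        linarith
      have ihs := ih s' e1 (e2.trans hs') e4
      obtain ⟨r1, r2⟩ := hrange s' e1 (e2.trans hs')
      have hk := harnack (F := W a ψ) (x0 := u s') (y0 := s') (x := u s) (y := s) (R := 1 / 32)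
        h.W_sm h.hη.continuous (fun x y h0 h1 => h.W_lap h0 h1)
        (fun x y h0 h1 => h.W_nonneg has h0.le h1.le) (by norm_num)
        (fun x y hxy => h.ball_in (by linarith) (hin s' (e2.trans hs')) r1 r2 hxy)
        (by
          have : u s - u s' = - a * (s - s') := by simp only [hu]; ring
          rw [this]
          have d0 : 0 ≤ s - s' := by linarith
          have d1 : s - s' ≤ 1 / 128 := by linarith
          have : (s - s') ^ 2 ≤ (1 / 128) ^ 2 := pow_le_pow_left₀ d0 d1 2
          have ha2 : a ^ 2 ≤ 1 := by nlinarith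
          nlinarith [mul_le_mul ha2 this (sq_nonneg _) (by norm_num)])
      rw [pow_succ]
      linarith
  have := chain ⌈384 * δ⌉₊ y hs2.2.le le_rfl (by
    have := Nat.le_ceil (384 * δ)
    rw [le_div_iff₀ (by norm_num)]
    linarith)
  rwa [huy] at this

lemma upper_lower (h : WFlow δ g T c ψ η) (has : ∀ x, 0 ≤ 1 + a * deriv η x) {β : ℝ} (hβ : 0 < β)
    (hlev : ∀ x y, 0 ≤ y → y ≤ η x → ψ x y = 1 / 2 → 5 / 4 * β ≤ W a ψ x y)
    {x y : ℝ} (h0 : 0 ≤ y) (h1 : y ≤ η x) (hh : 1 / 2 ≤ ψ x y) :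
    0 ≤ W a ψ x y - β * (4 - 7 * ψ x y + 3 * (ψ x y * ψ x y)) := by
  have sW : Sm (W a ψ) := h.W_sm
  have s1 : Sm (fun x y => 7 * ψ x y) := (Sm.const 7).mul h.hψ
  have s2 : Sm (fun x y => ψ x y * ψ x y) := h.hψ.mul h.hψ
  have s3 : Sm (fun x y => 3 * (ψ x y * ψ x y)) := (Sm.const 3).mul s2
  have s4 : Sm (fun x y => 4 - 7 * ψ x y) := (Sm.const 4).sub s1
  have s5 : Sm (fun x y => 4 - 7 * ψ x y + 3 * (ψ x y * ψ x y)) := s4.add s3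
  have s6 : Sm (fun x y => β * (4 - 7 * ψ x y + 3 * (ψ x y * ψ x y))) := (Sm.const β).mul s5
  set F : ℝ → ℝ → ℝ := fun x y => W a ψ x y - β * (4 - 7 * ψ x y + 3 * (ψ x y * ψ x y)) with hF
  have sF : Sm F := sW.sub s6
  obtain ⟨p, q, hpq, hmin⟩ := exists_min sF h.hT (M := 3 * δ)
    (fun x y => by simp only [hF]; rw [h.W_per, h.ψper])
    ({p : ℝ × ℝ | 0 ≤ p.2 ∧ p.2 ≤ η p.1} ∩ {p : ℝ × ℝ | 1 / 2 ≤ ψ p.1 p.2})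
    ((closed_dom h.hη.continuous).inter (isClosed_le continuous_const h.hψ.continuous))
    (fun x y => by simp [h.ηper, h.ψper])
    (fun p hp => ⟨hp.1.1, hp.1.2.trans (h.ηle _)⟩) ⟨(x, y), ⟨h0, h1⟩, hh⟩
  obtain ⟨⟨q0, q1⟩, q2⟩ := hpq
  simp only [mem_ofPred_eq] at q0 q1 q2
  have hle := hmin x y ⟨⟨h0, h1⟩, hh⟩
  refine le_trans ?_ hle
  rcases q1.eq_or_lt with e | q1'
  · simp only [hF]
    rw [e, h.surf]
    have := h.W_nonneg has (h.ηpos p).le le_rfl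
    linarith
  rcases q2.eq_or_lt with e | q2'
  · simp only [hF]
    rw [← e]
    have := hlev p q q0 q1 e.symm
    linarith
  exfalso
  have q0' : 0 < q := by
    rcases q0.eq_or_lt with e | e
    · rw [← e, h.bot] at q2; norm_num at q2
    · exact e
  obtain ⟨-, -, m3⟩ := min_cond sF (x := p) (y := q) (by
    filter_upwards [eventually_dom h.hη.continuous q0' q1',
      (isOpen_lt continuous_const h.hψ.continuous).mem_nhds
        (show (p, q) ∈ {p : ℝ × ℝ | 1 / 2 < ψ p.1 p.2} from q2')] with z hz hz'
    exact hmin z.1 z.2 ⟨⟨hz.1.le, hz.2.le⟩, le_of_lt hz'⟩)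
  have e3 : lap F p q = - β * (-7 + 6 * (px ψ p q ^ 2 + py ψ p q ^ 2) + 6 * ψ p q) := by
    simp only [hF]
    rw [lap_sub sW s6, lap_cmul β s5, lap_add s4 s3, lap_sub (Sm.const 4) s1, lap_cmul 7 h.hψ,
      lap_cmul 3 s2, lap_mul h.hψ h.hψ, h.lap1 p q q0' q1', h.W_lap q0' q1', lap_const]
    ring
  rw [e3] at m3
  have := h.grad_lower q0 q1
  nlinarith

lemma gravity_lower (h : WFlow δ g T c ψ η) {q x0 : ℝ} (hq : 1 < q) (hx0 : deriv η x0 = -q)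
    (hqm : ∀ x, -q ≤ deriv η x) :
    4 / 5 * ((1 / 3 : ℝ) ^ ⌈384 * δ⌉₊ * (1 / (12 * δ))) ≤ g := by
  have hδ := h.hδ
  set a := 1 / q with ha
  have haq : a * q = 1 := by rw [ha]; field_simp
  have ha0 : 0 < a := by rw [ha]; positivity
  have ha1 : a ≤ 1 := by nlinarith
  have has : ∀ x, 0 ≤ 1 + a * deriv η x := fun x => by nlinarith [hqm x]
  set β := 4 / 5 * ((1 / 3 : ℝ) ^ ⌈384 * δ⌉₊ * (1 / (12 * δ))) with hβ
  have hβ0 : 0 < β := by rw [hβ]; positivity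
  have hF : ∀ {x y : ℝ}, 0 ≤ y → y ≤ η x → 1 / 2 ≤ ψ x y → _ := fun {x y} => 
    h.upper_lower (a := a) has hβ0 (fun x y h0 h1 hl => by
      have := h.level_lower ha0 ha1 has h0 h1 hl
      rw [hβ]; linarith) (x := x) (y := y)
  have hX := h.hψ.px
  have hY := h.hψ.py
  set v := py ψ x0 (η x0) with hv
  have hvp : 0 < v := h.py_pos_surf x0
  have hux : px ψ x0 (η x0) = q * v := by rw [h.slope, hx0, hv]; ring
  have hW0 : W a ψ x0 (η x0) = 0 := by
    rw [h.W_surf, hx0]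
    have : 1 + a * -q = 0 := by linarith
    rw [this]; ring
  set A := px (px ψ) x0 (η x0) with hA
  set B := px (py ψ) x0 (η x0) with hB
  set C := py (py ψ) x0 (η x0) with hC
  have eW : W a ψ = fun x y => py ψ x y - a * px ψ x y := rfl
  have eWx : px (W a ψ) x0 (η x0) = B - a * A := by
    rw [eW, px_sub hY ((Sm.const a).mul hX), px_mul (Sm.const a) hX, px_const]
    ring
  have eWy : py (W a ψ) x0 (η x0) = C - a * B := by
    rw [eW, py_sub hY ((Sm.const a).mul hX), py_mul (Sm.const a) hX, py_const,
      h.hψ.py_px_fun]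
    ring
  have t1 : (B - a * A) - q * (C - a * B) = 0 := by
    have hd := (h.W_sm (a := a)).chain (hasDerivAt_id x0) (h.hdη x0)
    have hm : IsLocalMin (fun t => W a ψ (id t) (η t)) x0 := by
      refine Filter.Eventually.of_forall fun t => ?_
      simp only [id]
      rw [hW0]
      exact h.W_nonneg has (h.ηpos t).le le_rfl
    have := hm.hasDerivAt_eq_zero hd
    simp only [id] at this
    rw [eWx, eWy, hx0] at this
    linarith
  have t2 : q * v * A + v * B - q * (q * v * B + v * C) - q * g = 0 := by
    have hG : Sm (fun x y => px ψ x y * px ψ x y + py ψ x y * py ψ x y) :=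
      (hX.mul hX).add (hY.mul hY)
    have hd := (hG.chain (hasDerivAt_id x0) (h.hdη x0)).add ((h.hdη x0).const_mul (2 * g))
    have hc : (fun t => (px ψ (id t) (η t) * px ψ (id t) (η t)
        + py ψ (id t) (η t) * py ψ (id t) (η t))) + (fun t => 2 * g * η t) = fun _ => c := by
      ext t
      simp only [Pi.add_apply, id]
      have := h.bern t
      linarith
    rw [hc] at hd
    have := hd.unique (hasDerivAt_const x0 c)
    rw [px_add (hX.mul hX) (hY.mul hY), py_add (hX.mul hX) (hY.mul hY), px_mul hX hX,
      px_mul hY hY, py_mul hX hX, py_mul hY hY, h.hψ.py_px_fun] at this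
    simp only [id] at this
    rw [hx0, hux] at this
    linarith
  have t3 : (C - a * B) + β * v ≤ 0 := by
    by_contra! hlt
    have hd : HasDerivAt (fun t => W a ψ x0 t - β * (4 - 7 * ψ x0 t + 3 * (ψ x0 t * ψ x0 t)))
        ((C - a * B) - β * (-(7 * v) + 3 * (v * 1 + 1 * v))) (η x0) := by
      have d1 := (h.W_sm (a := a)).hdy x0 (η x0)
      have d2 := h.hψ.hdy x0 (η x0)
      have d3 := d1.sub ((((d2.const_mul 7).const_sub 4).add ((d2.mul d2).const_mul 3)).const_mul β)
      rw [eWy, h.surf] at d3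
      exact d3
    have hpos : 0 < deriv (fun t => W a ψ x0 t
        - β * (4 - 7 * ψ x0 t + 3 * (ψ x0 t * ψ x0 t))) (η x0) := by
      rw [hd.deriv]; linarith
    have h2 := eventually_nhdsWithin_sign_eq_of_deriv_pos hpos (by rw [hW0, h.surf]; ring)
    have h3 : ∀ᶠ t in nhdsWithin (η x0) (Iio (η x0)), t ∈ Ioo 0 (η x0) :=
      Ioo_mem_nhdsLT (h.ηpos x0)
    have h4 : nhdsWithin (η x0) (Iio (η x0)) ≤ nhds (η x0) := nhdsWithin_le_nhds
    have h6 : ∀ᶠ t in nhds (η x0), 1 / 2 < ψ x0 t := by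
      have := (h.hψ.hdy x0 (η x0)).continuousAt
      apply this.eventually (lt_mem_nhds _)
      simp only [h.surf]; norm_num
    obtain ⟨t, ⟨ht1, ht2⟩, ht3⟩ := ((h3.and (h4 h2)).and (h4 h6)).exists
    have h5 := hF ht1.1.le ht1.2.le ht3.le
    rw [sign_neg (by linarith [ht1.2] : t - η x0 < 0)] at ht2
    have := sign_eq_neg_one_iff.1 ht2
    linarith
  have hlo := h.lo x0
  rw [hux] at hlo
  -- (1+q^2) v (C - a B) = - g
  have key : (1 + q ^ 2) * (v * (C - a * B)) = - g := by
    have e1 : v * ((B - a * A) - q * (C - a * B)) = 0 := by rw [t1]; ring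
    have e2 : a * (q * v * A + v * B - q * (q * v * B + v * C) - q * g) = 0 := by rw [t2]; ring
    have hB' : B = a * q * B := by rw [haq]; ring
    have h1 : v * A + a * v * B - q * v * B - v * C - g = 0 := by
      linear_combination e2 - (v * A - q * v * B - v * C - g) * haq
    have h2 : q * C = 2 * B - a * A := by linear_combination -t1 + B * haq
    have h3 : C = 2 * a * B - a ^ 2 * A := by linear_combination a * h2 - C * haq
    have h4 : q * q * (C - a * B) = q * B - A := by
      rw [h3]
      linear_combination (q * B - A * (a * q + 1)) * haq
    linear_combination v * h4 - h1
  have : β * ((1 + q ^ 2) * v ^ 2) ≤ g := by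
    have : (1 + q ^ 2) * (v * ((C - a * B) + β * v)) ≤ 0 := by
      apply mul_nonpos_of_nonneg_of_nonpos (by positivity)
      exact mul_nonpos_of_nonneg_of_nonpos hvp.le t3
    linarith
  have h32 : 3 / 2 ≤ (1 + q ^ 2) * v ^ 2 := by rw [← hv] at hlo; linarith
  nlinarith

lemma core (h : WFlow δ g T c ψ η)
    (hgs : g < 4 / 5 * ((1 / 3 : ℝ) ^ ⌈384 * δ⌉₊ * (1 / (12 * δ)))) {x y : ℝ}
    (h0 : 0 ≤ y) (h1 : y ≤ η x) : y / (5 * δ) ≤ py ψ x y := by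
  have hδ := h.hδ
  have hsm : Sm (fun x _ => deriv η x) := by
    have : ContDiff ℝ (⊤ : ℕ∞) (deriv η) := by
      have := h.hη
      exact (contDiff_infty_iff_deriv.1 this).2
    exact ContDiff.comp this contDiff_fst
  have dper : ∀ x, deriv η (x + T) = deriv η x := by
    intro x
    rw [← deriv_comp_add_const]
    congr 1; ext t; exact h.ηper t
  have dodd : ∀ x, deriv η (-x) = - deriv η x := by
    intro x
    have := deriv_comp_neg η x
    rw [show (fun x => η (-x)) = η from funext h.ηeven] at this
    linarith
  obtain ⟨x0, b, -, hmin⟩ := exists_min hsm (T := T) (M := 0) h.hT (fun x y => dper x)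
    {p | p.2 = 0} (isClosed_eq continuous_snd continuous_const) (fun x y => by simp)
    (fun p hp => ⟨le_of_eq hp.symm, le_of_eq hp⟩) ⟨(0, 0), rfl⟩
  have hm : ∀ x, deriv η x0 ≤ deriv η x := fun x => hmin x 0 rfl
  rcases lt_or_ge 1 (-deriv η x0) with hq | hq
  · have := h.gravity_lower hq (by ring) (fun x => by linarith [hm x])
    linarith
  have htop : ∀ x, 3 / 5 ≤ py ψ x (η x) := by
    intro x
    have l1 : -1 ≤ deriv η x := by linarith [hm x]
    have l2 : deriv η x ≤ 1 := by have := hm (-x); rw [dodd] at this; linarith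
    have hlo := h.lo x
    have hp := h.py_pos_surf x
    rw [h.slope] at hlo
    have : deriv η x ^ 2 ≤ 1 := by nlinarith
    by_contra! hlt
    have h2 : py ψ x (η x) ^ 2 ≤ (3 / 5) ^ 2 := pow_le_pow_left₀ hp.le hlt.le 2
    nlinarith [mul_le_mul this h2 (sq_nonneg _) (by norm_num)]
  have sL : Sm (fun _ y => (1 / (5 * δ)) * y) := (Sm.const _).mul Sm.snd
  have := min_principle (F := fun x y => py ψ x y - (1 / (5 * δ)) * y) (h.hψ.py.sub sL)
    h.hη.continuous h.hT (fun x y => by rw [py_per h.ψper]) h.ηper h.ηle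
    (fun x y h0 h1 => by
      rw [lap_sub h.hψ.py sL, lap_cmul _ Sm.snd, lap_snd, h.lap_py h0 h1]; simp)
    (fun x _ => by
      have e : 1 / (5 * δ) * η x ≤ 3 / 5 := by
        rw [one_div, inv_mul_le_iff₀ (by linarith)]
        linarith [h.ηle x]
      linarith [htop x])
    (fun x => by
      have := h.py_nonneg (x := x) le_rfl (h.ηpos x).le
      linarith) x y h0 h1
  have e : y / (5 * δ) = 1 / (5 * δ) * y := by ring
  linarith

end WFlow

lemma px_scale {F : ℝ → ℝ → ℝ} (hF : Sm F) (m k : ℝ) :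
    px (fun x y => m * F (x / k) (y / k)) = fun x y => (m / k) * px F (x / k) (y / k) := by
  ext x y
  have h1 := (hF.chain ((hasDerivAt_id x).div_const k) (hasDerivAt_const x (y / k))).const_mul m
  rw [px, show (fun t => m * F (t / k) (y / k)) = fun t => m * F (id t / k) (y / k) from rfl,
    h1.deriv]
  simp only [id]; ring

lemma py_scale {F : ℝ → ℝ → ℝ} (hF : Sm F) (m k : ℝ) :
    py (fun x y => m * F (x / k) (y / k)) = fun x y => (m / k) * py F (x / k) (y / k) := by
  ext x y
  have h1 := (hF.chain (hasDerivAt_const y (x / k)) ((hasDerivAt_id y).div_const k)).const_mul m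
  rw [py, show (fun t => m * F (x / k) (t / k)) = fun t => m * F (x / k) (id t / k) from rfl,
    h1.deriv]
  simp only [id]; ring

lemma eta_le_crest {γ r Λ : ℝ} {ψ : ℝ → ℝ → ℝ} {η : ℝ → ℝ} (h : StokesWave γ ψ η r Λ) (x : ℝ) :
    η x ≤ η 0 := by
  have hp : Function.Periodic η (2 * Λ) := h.eta_periodic
  have hΛ := h.lam_pos
  obtain ⟨y, hy, hxy⟩ := hp.exists_mem_Ico (by linarith) x (-Λ)
  have habs : η |y| = η y := by
    rcases abs_choice y with e | e
    · rw [e]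
    · rw [e, h.eta_even]
  rw [hxy, ← habs]
  have hmem : |y| ∈ Icc 0 Λ := ⟨abs_nonneg y, abs_le.2 ⟨hy.1, by linarith [hy.2]⟩⟩
  exact h.eta_anti.antitoneOn ⟨le_rfl, hΛ.le⟩ hmem (abs_nonneg y)

set_option maxHeartbeats 1000000 in
/-- Proposition 2.4: if `ψ_y ≥ √(2γ) - δ/γ` at the crest, then `ψ_y ≥ C₁ γ δ⁻¹ y`
everywhere in the fluid and `η̂ ≤ C₂ δ √(2/γ)`, provided `γ > γ₁(δ)`. -/
theorem linear_lower_bound_for_py :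
    ∃ C₁ > (0 : ℝ), ∃ C₂ > (0 : ℝ), ∀ δ ≥ (1 : ℝ), ∃ γ₁ > (0 : ℝ), ∀ γ > γ₁,
      ∀ (ψ : ℝ → ℝ → ℝ) (η : ℝ → ℝ) (r Λ sc : ℝ),
        StokesWave γ ψ η r Λ → Unidirectional ψ η → IsCrit γ sc →
        bernR γ sc < r → r < bernR γ 0 →
        py ψ 0 (η 0) ≥ Real.sqrt (2 * γ) - δ / γ →
        (∀ x y : ℝ, 0 ≤ y → y ≤ η x → py ψ x y ≥ C₁ * γ * δ⁻¹ * y) ∧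
        η 0 ≤ C₂ * δ * Real.sqrt (2 / γ) := by
  refine ⟨1 / 5, by norm_num, 2, by norm_num, fun δ hδ => ?_⟩
  set β : ℝ := 4 / 5 * ((1 / 3 : ℝ) ^ ⌈384 * δ⌉₊ * (1 / (12 * δ))) with hβ
  have hβ0 : 0 < β := by rw [hβ]; positivity
  refine ⟨10 * δ + 1 / β, by positivity, ?_⟩
  intro γ hγ ψ η r Λ sc hS hU _ _ hr hcrest
  have hβi : 0 < 1 / β := by positivity
  have hγ10 : 10 * δ < γ := by linarith
  have hγβ : 1 / β < γ := by linarith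
  have hγ0 : 0 < γ := by linarith
  set k := Real.sqrt γ with hk
  have hkk : k * k = γ := Real.mul_self_sqrt hγ0.le
  have hk0 : 0 < k := Real.sqrt_pos.2 hγ0
  have hk1 : 1 ≤ k := by nlinarith
  set s := Real.sqrt 2 with hs
  have hss : s * s = 2 := Real.mul_self_sqrt (by norm_num)
  have hs0 : 0 < s := Real.sqrt_pos.2 (by norm_num)
  have hs15 : s ≤ 3 / 2 := by nlinarith
  have e1 : Real.sqrt (2 * γ) = s * k := Real.sqrt_mul (by norm_num) γ
  have e2 : Real.sqrt (2 / γ) = s / k := Real.sqrt_div (by norm_num) γ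
  have e3 : bernR γ 0 = γ + s / k := by
    unfold bernR lamDepth
    rw [show (0 : ℝ) ^ 2 + 2 * γ = 2 * γ by ring, e1, ← hkk]
    field_simp
    ring
  rw [e3] at hr
  rw [e1] at hcrest
  rw [e2]
  have hsol := hS.sol
  have hψ : Sm ψ := hsol.psi_smooth
  have hik : 0 < 1 / k := by positivity
  have hik1 : 1 / k ≤ 1 := by rw [div_le_one hk0]; exact hk1
  have hδk : 0 ≤ δ / k := by positivity
  have hδk' : δ / k ≤ δ := div_le_self (by linarith) hk1
  have hsk : s / k ≤ 3 / 2 := (div_le_self hs0.le hk1).trans hs15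
  have hsδ : s * (δ / k) ≤ 3 / 2 * δ := by nlinarith
  have hδγ : δ / γ ≤ 1 / 10 := by rw [div_le_iff₀ hγ0]; linarith
  have hδγ0 : 0 ≤ δ / γ := by positivity
  have hs1 : 1 ≤ s := by nlinarith
  have hbase : 0 ≤ s * k - δ / γ := by nlinarith
  have hsq : 2 * γ - 2 * (s * (δ / k)) ≤ py ψ 0 (η 0) ^ 2 := by
    have h1 : (s * k - δ / γ) ^ 2 ≤ py ψ 0 (η 0) ^ 2 := pow_le_pow_left₀ hbase hcrest 2
    have h2 : k * (δ / γ) = δ / k := by rw [← hkk]; field_simp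
    have h3 : (s * k - δ / γ) ^ 2 = 2 * γ - 2 * (s * (δ / k)) + (δ / γ) ^ 2 := by
      rw [← h2]; linear_combination k * k * hss + 2 * hkk
    nlinarith [sq_nonneg (δ / γ)]
  have hb0 := hsol.bernoulli 0
  have hη0 : η 0 ≤ 2 * δ * (s / k) := by
    have h1 : s * (δ / k) = δ * (s / k) := by ring
    have h2 : 0 < s / k := by positivity
    nlinarith [sq_nonneg (px ψ 0 (η 0))]
  refine ⟨?_, hη0⟩
  have hlo : ∀ x, 3 / 2 * γ ≤ px ψ x (η x) ^ 2 + py ψ x (η x) ^ 2 := by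
    intro x
    have := hsol.bernoulli x
    have := eta_le_crest hS x
    linarith [sq_nonneg (px ψ 0 (η 0))]
  have hhi : ∀ x, px ψ x (η x) ^ 2 + py ψ x (η x) ^ 2 ≤ 4 * γ := by
    intro x
    have := hsol.bernoulli x
    have := hsol.eta_pos x
    linarith
  have eΨ : ∀ F : ℝ → ℝ → ℝ, (fun x y => F (x / k) (y / k)) =
      fun x y => 1 * F (x / k) (y / k) := by
    intro F; ext x y; ring
  set Ψ : ℝ → ℝ → ℝ := fun x y => 1 * ψ (x / k) (y / k) with hΨ
  set H : ℝ → ℝ := fun x => k * η (x / k) with hH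
  have epx : px Ψ = fun x y => (1 / k) * px ψ (x / k) (y / k) := px_scale hψ 1 k
  have epy : py Ψ = fun x y => (1 / k) * py ψ (x / k) (y / k) := py_scale hψ 1 k
  have hHk : ∀ x, H x / k = η (x / k) := by
    intro x; simp only [hH]; field_simp
  have hsurfsq : ∀ x, px Ψ x (H x) ^ 2 + py Ψ x (H x) ^ 2
      = (px ψ (x / k) (η (x / k)) ^ 2 + py ψ (x / k) (η (x / k)) ^ 2) / γ := by
    intro x
    rw [epx, epy]
    simp only [hHk]
    rw [← hkk]; field_simp
  have hdiv : ∀ x, (x + 2 * Λ * k) / k = x / k + 2 * Λ := by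
    intro x; field_simp
  have hlt : ∀ x y, y < H x → y / k < η (x / k) := by
    intro x y hy
    rw [div_lt_iff₀ hk0]
    simp only [hH] at hy; linarith
  have flow : WFlow δ (1 / (γ * k)) (2 * Λ * k) (2 * r / γ) Ψ H :=
    { hψ := by
        have h1 : ContDiff ℝ (⊤ : ℕ∞) (fun p : ℝ × ℝ => (p.1 / k, p.2 / k)) := by fun_prop
        exact contDiff_const.mul (ContDiff.comp hψ h1)
      hη := contDiff_const.mul (hsol.eta_smooth.comp (by fun_prop))
      hT := by have := hS.lam_pos; positivity
      hg := by positivity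
      hδ := hδ
      ηper := fun x => by simp only [hH]; rw [hdiv, hS.eta_periodic]
      ηeven := fun x => by simp only [hH]; rw [neg_div, hS.eta_even]
      ψper := fun x y => by simp only [hΨ]; rw [hdiv, hS.psi_periodic]
      ηpos := fun x => mul_pos hk0 (hsol.eta_pos _)
      ηle := fun x => by
        have h1 := eta_le_crest hS (x / k)
        have h2 : k * (2 * δ * (s / k)) = 2 * δ * s := by field_simp
        have h3 : k * η (x / k) ≤ k * (2 * δ * (s / k)) :=
          mul_le_mul_of_nonneg_left (h1.trans hη0) hk0.le
        simp only [hH]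
        nlinarith
      lap1 := fun x y hy0 hy1 => by
        have := hsol.laplace (x / k) (y / k) (by positivity) (hlt x y hy1)
        rw [pxx_eq, pyy_eq] at this
        simp only [lap, pxx_eq, pyy_eq]
        rw [epx, epy, px_scale hψ.px, py_scale hψ.py]
        have h1 : 1 / k / k = 1 / γ := by rw [← hkk]; field_simp
        rw [h1, ← mul_add, this]
        field_simp
      surf := fun x => by simp only [hΨ, hHk]; rw [hsol.surface_val]; ring
      bot := fun x => by simp only [hΨ, zero_div]; rw [hsol.bottom_val]; ring
      uni := fun x y hy0 hy1 => by
        rw [epy]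
        exact mul_pos hik (hU _ _ (by positivity) (hlt x y hy1))
      bern := fun x => by
        rw [hsurfsq]
        have := hsol.bernoulli (x / k)
        simp only [hH]
        rw [← this]
        field_simp
      lo := fun x => by
        rw [hsurfsq, le_div_iff₀ hγ0]; exact hlo _
      hi := fun x => by
        rw [hsurfsq, div_le_iff₀ hγ0]; exact hhi _ }
  have hgs : 1 / (γ * k) < β := by
    rw [div_lt_iff₀ (by positivity)]
    rw [div_lt_iff₀ hβ0] at hγβ
    nlinarith [mul_pos hγ0 hβ0]
  intro x y hy0 hy1
  have hx : k * x / k = x := by field_simp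
  have hy : k * y / k = y := by field_simp
  have hc := flow.core hgs (x := k * x) (y := k * y) (by positivity)
    (by simp only [hH]; rw [hx]; exact mul_le_mul_of_nonneg_left hy1 hk0.le)
  rw [epy] at hc
  simp only [hx, hy] at hc
  have h1 : k * (k * y / (5 * δ)) ≤ k * (1 / k * py ψ x y) := mul_le_mul_of_nonneg_left hc hk0.le
  have h2 : k * (1 / k * py ψ x y) = py ψ x y := by field_simp
  have h3 : k * (k * y / (5 * δ)) = 1 / 5 * γ * δ⁻¹ * y := by
    rw [← hkk]; field_simp
  linarith
end
end

section
/- Let γ > 0, let (ψ, η, r) be a unidirectional Stokes wave solution, and let λ ≥ γ/2. Then the function ζ(x) = ψ_y(x, η(x)) − λ·η(x) attains its minimum at the crest: ζ(0) ≤ ζ(x) for all x ∈ ℝ. -/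
noncomputable section

open Real Set

/-- Joint smoothness of a curried function. -/
def Smooth2 (f : ℝ → ℝ → ℝ) : Prop := ContDiff ℝ (⊤ : ℕ∞) (fun p : ℝ × ℝ => f p.1 p.2)

lemma Smooth2.diff {f : ℝ → ℝ → ℝ} (hf : Smooth2 f) (p : ℝ × ℝ) :
    DifferentiableAt ℝ (fun p : ℝ × ℝ => f p.1 p.2) p :=
  (ContDiff.differentiable hf (by simp)) p

lemma Smooth2.curve {f : ℝ → ℝ → ℝ} (hf : Smooth2 f) {a b : ℝ → ℝ} {a' b' t : ℝ}
    (ha : HasDerivAt a a' t) (hb : HasDerivAt b b' t) :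
    HasDerivAt (fun s => f (a s) (b s))
      (fderiv ℝ (fun p : ℝ × ℝ => f p.1 p.2) (a t, b t) (a', b')) t :=
  HasFDerivAt.comp_hasDerivAt (f := fun s => (a s, b s)) t (hf.diff (a t, b t)).hasFDerivAt
    (ha.prodMk hb)

lemma Smooth2.px_eq {f : ℝ → ℝ → ℝ} (hf : Smooth2 f) (x y : ℝ) :
    px f x y = fderiv ℝ (fun p : ℝ × ℝ => f p.1 p.2) (x, y) (1, 0) :=
  (hf.curve (hasDerivAt_id x) (hasDerivAt_const x y)).deriv

lemma Smooth2.py_eq {f : ℝ → ℝ → ℝ} (hf : Smooth2 f) (x y : ℝ) :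
    py f x y = fderiv ℝ (fun p : ℝ × ℝ => f p.1 p.2) (x, y) (0, 1) :=
  (hf.curve (hasDerivAt_const y x) (hasDerivAt_id y)).deriv

lemma Smooth2.hx {f : ℝ → ℝ → ℝ} (hf : Smooth2 f) (x y : ℝ) :
    HasDerivAt (fun t => f t y) (px f x y) x := by
  rw [hf.px_eq]
  exact hf.curve (hasDerivAt_id x) (hasDerivAt_const x y)

lemma Smooth2.hy {f : ℝ → ℝ → ℝ} (hf : Smooth2 f) (x y : ℝ) :
    HasDerivAt (fun t => f x t) (py f x y) y := by
  rw [hf.py_eq]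
  exact hf.curve (hasDerivAt_const y x) (hasDerivAt_id y)

lemma Smooth2.graph {f : ℝ → ℝ → ℝ} (hf : Smooth2 f) {b : ℝ → ℝ} {b' t : ℝ}
    (hb : HasDerivAt b b' t) :
    HasDerivAt (fun s => f s (b s)) (px f t (b t) + b' * py f t (b t)) t := by
  have h := hf.curve (hasDerivAt_id t) hb
  have e : ((1 : ℝ), b') = (1, 0) + b' • ((0 : ℝ), (1 : ℝ)) := by simp
  rw [e, map_add, map_smul] at h
  rw [hf.px_eq, hf.py_eq]
  exact h

lemma Smooth2.px {f : ℝ → ℝ → ℝ} (hf : Smooth2 f) : Smooth2 (px f) := by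
  have : (fun p : ℝ × ℝ => _root_.px f p.1 p.2) =
      fun p => fderiv ℝ (fun p : ℝ × ℝ => f p.1 p.2) p (1, 0) := by
    funext p; exact hf.px_eq _ _
  unfold Smooth2
  rw [this]
  exact (ContDiff.fderiv_right hf (by simp)).clm_apply contDiff_const

lemma Smooth2.py {f : ℝ → ℝ → ℝ} (hf : Smooth2 f) : Smooth2 (py f) := by
  have : (fun p : ℝ × ℝ => _root_.py f p.1 p.2) =
      fun p => fderiv ℝ (fun p : ℝ × ℝ => f p.1 p.2) p (0, 1) := by
    funext p; exact hf.py_eq _ _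
  unfold Smooth2
  rw [this]
  exact (ContDiff.fderiv_right hf (by simp)).clm_apply contDiff_const

lemma Smooth2.cont {f : ℝ → ℝ → ℝ} (hf : Smooth2 f) :
    Continuous (fun p : ℝ × ℝ => f p.1 p.2) := ContDiff.continuous hf

lemma Smooth2.comm {f : ℝ → ℝ → ℝ} (hf : Smooth2 f) :
    _root_.px (_root_.py f) = _root_.py (_root_.px f) := by
  funext x y
  rw [hf.py.px_eq, hf.px.py_eq]
  have e1 : (fun p : ℝ × ℝ => _root_.px f p.1 p.2) =
      fun p => fderiv ℝ (fun p : ℝ × ℝ => f p.1 p.2) p (1, 0) := by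
    funext p; exact hf.px_eq _ _
  have e2 : (fun p : ℝ × ℝ => _root_.py f p.1 p.2) =
      fun p => fderiv ℝ (fun p : ℝ × ℝ => f p.1 p.2) p (0, 1) := by
    funext p; exact hf.py_eq _ _
  rw [e1, e2]
  have hd : DifferentiableAt ℝ (fderiv ℝ (fun p : ℝ × ℝ => f p.1 p.2)) (x, y) := by
    have h : ContDiff ℝ (⊤ : ℕ∞) (fderiv ℝ (fun p : ℝ × ℝ => f p.1 p.2)) :=
      ContDiff.fderiv_right hf (by simp)
    exact h.differentiable (by simp) _
  have k : ∀ v w : ℝ × ℝ,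
      fderiv ℝ (fun p => fderiv ℝ (fun p : ℝ × ℝ => f p.1 p.2) p v) (x, y) w =
      fderiv ℝ (fderiv ℝ (fun p : ℝ × ℝ => f p.1 p.2)) (x, y) w v := by
    intro v w
    have := (hd.hasFDerivAt.clm_apply (hasFDerivAt_const v (x, y))).fderiv
    rw [this]
    simp
  rw [k, k]
  exact second_derivative_symmetric (fun p => (hf.diff p).hasFDerivAt) hd.hasFDerivAt _ _

/-- The second derivative at a local minimum is nonnegative. -/
lemma second_deriv_nonneg {g : ℝ → ℝ} {a : ℝ} (hg : IsLocalMin g a) (hc : ContinuousAt g a) :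
    0 ≤ deriv (deriv g) a := by
  by_contra hneg
  push Not at hneg
  have h0 := hg.deriv_eq_zero
  have hM := isLocalMax_of_deriv_deriv_neg hneg h0 hc
  have he : g =ᶠ[nhds a] fun _ => g a := by
    filter_upwards [hg, hM] with t h1 h2
    exact le_antisymm h2 h1
  have := he.deriv.deriv_eq
  simp at this
  linarith

/-- Minimum on the right: the derivative is nonneg. -/
lemma deriv_nonneg_of_right {g : ℝ → ℝ} {g' a b : ℝ} (hab : a < b) (hg : HasDerivAt g g' a)
    (h : ∀ t ∈ Icc a b, g a ≤ g t) : 0 ≤ g' := by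
  have h1 := (hasDerivAt_iff_tendsto_slope.1 hg).mono_left
    (nhdsWithin_mono a (fun t (ht : t ∈ Ioi a) => ne_of_gt ht))
  refine ge_of_tendsto h1 ?_
  filter_upwards [Ioo_mem_nhdsGT hab] with t ht
  rw [slope_def_field]
  exact div_nonneg (by linarith [h t ⟨ht.1.le, ht.2.le⟩]) (by linarith [ht.1])

lemma deriv_nonpos_of_left {g : ℝ → ℝ} {g' a b : ℝ} (hab : a < b) (hg : HasDerivAt g g' b)
    (h : ∀ t ∈ Icc a b, g b ≤ g t) : g' ≤ 0 := by
  have h2 : HasDerivAt (fun s => g (-s)) (-g') (-b) := by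
    have h3 : HasDerivAt g g' (-(-b)) := by simpa using hg
    simpa [Function.comp_def] using h3.comp (-b) (hasDerivAt_neg (-b))
  have := deriv_nonneg_of_right (a := -b) (b := -a) (by linarith) h2 (by
    intro t ht
    simp only [neg_neg]
    exact h (-t) ⟨by linarith [ht.2], by linarith [ht.1]⟩)
  linarith

lemma min_principle_s13 {S : ℝ → ℝ → ℝ} {η : ℝ → ℝ} {c : ℝ} (hS : Smooth2 S) (hη : Continuous η)
    (hpos : ∀ x, 0 < η x) (hc : 0 < c) (hpη : ∀ x, η (x + c) = η x)
    (hpS : ∀ x y, S (x + c) y = S x y)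
    (hlap : ∀ x y, 0 < y → y < η x → px (px S) x y + py (py S) x y ≤ 0)
    (hbot : ∀ x, py S x 0 < 0) (hsurf : ∀ x, S x (η x) = 0) :
    ∀ x y, 0 ≤ y → y ≤ η x → 0 ≤ S x y := by
  have hper : Function.Periodic (fun x => (η x, S x)) c := by
    intro x
    simp only [hpη, Prod.mk.injEq, true_and]
    funext y
    exact hpS x y
  have hred : ∀ x, ∃ x' ∈ Icc 0 c, η x = η x' ∧ S x = S x' := by
    intro x
    obtain ⟨x', h1, h2⟩ := hper.exists_mem_Ico hc x 0
    rw [zero_add] at h1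
    exact ⟨x', ⟨h1.1, h1.2.le⟩, (Prod.mk.inj h2).1, (Prod.mk.inj h2).2⟩
  obtain ⟨H, hH⟩ : ∃ H, ∀ x, η x ≤ H := by
    obtain ⟨z, -, hz⟩ := (isCompact_Icc (a := (0:ℝ)) (b := c)).exists_isMaxOn
      ⟨0, by simp [hc.le]⟩ hη.continuousOn
    refine ⟨η z, fun x => ?_⟩
    obtain ⟨x', h1, h2, -⟩ := hred x
    rw [h2]; exact hz h1
  have hHpos : 0 < H := (hpos 0).trans_le (hH 0)
  intro x₁ y₁ hy₁ hy₁'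
  by_contra hneg
  push Not at hneg
  set ε : ℝ := -S x₁ y₁ / (2 * (H ^ 2 + 1)) with hε
  have hεpos : 0 < ε := div_pos (by linarith) (by positivity)
  have hεe : ε * (2 * (H ^ 2 + 1)) = -S x₁ y₁ := by rw [hε]; field_simp
  let K : Set (ℝ × ℝ) := {p | p ∈ Icc (0:ℝ) c ×ˢ Icc 0 H ∧ p.2 ≤ η p.1}
  have hK : IsCompact K := by
    apply (isCompact_Icc.prod isCompact_Icc).inter_right
    exact isClosed_le continuous_snd (hη.comp continuous_fst)
  have hTc : Continuous (fun p : ℝ × ℝ => S p.1 p.2 - ε * p.2 ^ 2) :=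
    hS.cont.sub (by fun_prop)
  obtain ⟨q, hqK, hqmin⟩ := hK.exists_isMinOn
    ⟨(0, 0), ⟨⟨⟨le_rfl, hc.le⟩, ⟨le_rfl, hHpos.le⟩⟩, (hpos 0).le⟩⟩ hTc.continuousOn
  obtain ⟨a, b⟩ := q
  have hb0 : 0 ≤ b := hqK.1.2.1
  have hbη : b ≤ η a := hqK.2
  have hmin : ∀ x y, 0 ≤ y → y ≤ η x → S a b - ε * b ^ 2 ≤ S x y - ε * y ^ 2 := by
    intro x y h0 h1
    obtain ⟨x', h2, h3, h4⟩ := hred x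
    rw [h4]
    exact hqmin (a := (x', y)) ⟨⟨h2, ⟨h0, h1.trans (hH x)⟩⟩, by simpa [← h3] using h1⟩
  have hval := hmin x₁ y₁ hy₁ hy₁'
  have hεy : 0 ≤ ε * y₁ ^ 2 := by positivity
  have hbH : b ^ 2 ≤ H ^ 2 := by
    have := hbη.trans (hH a)
    gcongr
  have hεb : ε * b ^ 2 ≤ ε * H ^ 2 := by gcongr
  have hTy : ∀ y, HasDerivAt (fun t => S a t - ε * t ^ 2) (py S a y - ε * (2 * y)) y := by
    intro y
    have := ((hasDerivAt_id y).pow 2).const_mul ε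
    refine (hS.hy a y).sub ?_
    simpa using this
  rcases hbη.eq_or_lt with hb | hb
  · -- surface
    have := hsurf a
    rw [← hb] at this
    nlinarith
  rcases hb0.eq_or_lt with h0 | h0
  · -- bottom
    have h1 := deriv_nonneg_of_right (hpos a) (hTy 0) (by
      intro t ht
      have := hmin a t ht.1 ht.2
      rw [← h0] at this
      exact this)
    have := hbot a
    linarith
  · -- interior
    have hlx : IsLocalMin (fun t => S t b) a := by
      have : ∀ᶠ t in nhds a, b < η t := hη.continuousAt.eventually (lt_mem_nhds hb)
      filter_upwards [this] with t ht
      have := hmin t b h0.le ht.le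
      linarith
    have hly : IsLocalMin (fun t => S a t - ε * t ^ 2) b := by
      filter_upwards [Ioo_mem_nhds h0 hb] with t ht
      exact hmin a t ht.1.le ht.2.le
    have h1 := second_deriv_nonneg hlx (hS.hx a b).continuousAt
    have h2 := second_deriv_nonneg hly (hTy b).continuousAt
    have e1 : deriv (deriv (fun t => S t b)) a = px (px S) a b := rfl
    have e2 : deriv (deriv (fun t => S a t - ε * t ^ 2)) b = py (py S) a b - 2 * ε := by
      have : deriv (fun t => S a t - ε * t ^ 2) = fun y => py S a y - ε * (2 * y) :=
        funext fun y => (hTy y).deriv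
      rw [this]
      have h := (hS.py.hy a b).sub (((hasDerivAt_id b).const_mul 2).const_mul ε)
      have h' := h.deriv
      simp only [id] at h'
      rw [mul_one, mul_comm ε 2] at h'
      exact h'
    rw [e1] at h1
    rw [e2] at h2
    have := hlap a b h0 hb
    linarith

lemma nonneg_closure {g : ℝ → ℝ} {b : ℝ} (hb : 0 < b) (hg : Continuous g)
    (h : ∀ y, 0 < y → y < b → 0 ≤ g y) : ∀ y ∈ Icc 0 b, 0 ≤ g y := by
  intro y hy
  rw [← closure_Ioo hb.ne] at hy
  have : closure (Ioo 0 b) ⊆ {y | 0 ≤ g y} :=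
    closure_minimal (fun z hz => h z hz.1 hz.2) (isClosed_le continuous_const hg)
  exact this hy

/-- The comparison function `P - λ (ψ - 1)`, with `P` the pressure. -/
def compS (ψ : ℝ → ℝ → ℝ) (r κ : ℝ) (x y : ℝ) : ℝ :=
  r - y - (px ψ x y ^ 2 + py ψ x y ^ 2) / 2 + κ * (ψ x y - 1)

lemma compS_smooth {ψ : ℝ → ℝ → ℝ} (h : Smooth2 ψ) (r κ : ℝ) : Smooth2 (compS ψ r κ) := by
  have h1 : ContDiff ℝ (⊤ : ℕ∞) (fun p : ℝ × ℝ => px ψ p.1 p.2) := h.px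
  have h2 : ContDiff ℝ (⊤ : ℕ∞) (fun p : ℝ × ℝ => py ψ p.1 p.2) := h.py
  have h3 : ContDiff ℝ (⊤ : ℕ∞) (fun p : ℝ × ℝ => ψ p.1 p.2) := h
  unfold Smooth2 compS
  fun_prop

lemma compS_px {ψ : ℝ → ℝ → ℝ} (h : Smooth2 ψ) (r κ : ℝ) : px (compS ψ r κ) = fun x y =>
    -(px ψ x y * px (px ψ) x y) - py ψ x y * px (py ψ) x y + κ * px ψ x y := by
  funext x y
  have h1 := (((hasDerivAt_const x (r - y)).sub
    ((((h.px.hx x y).pow 2).add ((h.py.hx x y).pow 2)).div_const 2)).add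
      (((h.hx x y).sub_const 1).const_mul κ))
  refine h1.deriv.trans ?_
  push_cast
  ring

lemma compS_py {ψ : ℝ → ℝ → ℝ} (h : Smooth2 ψ) (r κ : ℝ) : py (compS ψ r κ) = fun x y =>
    -1 - px ψ x y * py (px ψ) x y - py ψ x y * py (py ψ) x y + κ * py ψ x y := by
  funext x y
  have h1 := ((((hasDerivAt_id y).const_sub r).sub
    ((((h.px.hy x y).pow 2).add ((h.py.hy x y).pow 2)).div_const 2)).add
      (((h.hy x y).sub_const 1).const_mul κ))
  refine h1.deriv.trans ?_
  push_cast
  ring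

lemma compS_pxx {ψ : ℝ → ℝ → ℝ} (h : Smooth2 ψ) (r κ x y : ℝ) : px (px (compS ψ r κ)) x y =
    -(px (px ψ) x y ^ 2) - px ψ x y * px (px (px ψ)) x y - px (py ψ) x y ^ 2
      - py ψ x y * px (px (py ψ)) x y + κ * px (px ψ) x y := by
  rw [compS_px h]
  have h1 := ((((h.px.hx x y).mul (h.px.px.hx x y)).neg.sub
    ((h.py.hx x y).mul (h.py.px.hx x y))).add ((h.px.hx x y).const_mul κ))
  refine h1.deriv.trans ?_
  ring

lemma compS_pyy {ψ : ℝ → ℝ → ℝ} (h : Smooth2 ψ) (r κ x y : ℝ) : py (py (compS ψ r κ)) x y =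
    -(py (px ψ) x y ^ 2) - px ψ x y * py (py (px ψ)) x y - py (py ψ) x y ^ 2
      - py ψ x y * py (py (py ψ)) x y + κ * py (py ψ) x y := by
  rw [compS_py h]
  have h1 := (((((h.px.hy x y).mul (h.px.py.hy x y)).const_sub (-1)).sub
    ((h.py.hy x y).mul (h.py.py.hy x y))).add ((h.py.hy x y).const_mul κ))
  refine h1.deriv.trans ?_
  ring

/-- Lemma 4.2: for any `λ ≥ γ/2`, the function `ζ(x) = ψ_y(x, η(x)) - λ η(x)` attains
its minimum at the crest `x = 0`. -/
theorem zeta_min_at_crest :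
    ∀ γ > (0 : ℝ),
      ∀ (ψ : ℝ → ℝ → ℝ) (η : ℝ → ℝ) (r Λ lam : ℝ),
        StokesWave γ ψ η r Λ → Unidirectional ψ η →
        γ / 2 ≤ lam →
        ∀ x : ℝ, py ψ 0 (η 0) - lam * η 0 ≤ py ψ x (η x) - lam * η x := by
  intro γ hγ ψ η r Λ lam hw hu hlam
  have hψ : Smooth2 ψ := hw.sol.psi_smooth
  have hηs := hw.sol.eta_smooth
  have hηc : Continuous η := hηs.continuous
  have hηd : ∀ x, HasDerivAt η (deriv η x) x := fun x =>
    (hηs.differentiable (by simp) x).hasDerivAt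
  have hpos := hw.sol.eta_pos
  have hΛ := hw.lam_pos
  have hcomm := hψ.comm
  have hcomm2 := hψ.py.comm
  have hcomm1 := hψ.px.comm
  have hline : ∀ {f : ℝ → ℝ → ℝ}, Smooth2 f → ∀ x, Continuous (f x) := fun hf x =>
    hf.cont.comp (Continuous.prodMk_right x)
  -- closure versions
  have hun : ∀ x, ∀ y ∈ Icc 0 (η x), 0 ≤ py ψ x y := fun x =>
    nonneg_closure (hpos x) (hline hψ.py x) (fun y h1 h2 => (hu x y h1 h2).le)
  have hlapo : ∀ x y, 0 < y → y < η x → px (px ψ) x y + py (py ψ) x y = γ := hw.sol.laplace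
  have hlapc : ∀ x, ∀ y ∈ Icc 0 (η x), px (px ψ) x y + py (py ψ) x y = γ := by
    intro x y hy
    have hc : Continuous (fun y => px (px ψ) x y + py (py ψ) x y) :=
      (hline hψ.px.px x).add (hline hψ.py.py x)
    have h1 := nonneg_closure (hpos x) (hc.sub continuous_const)
      (fun y h1 h2 => (sub_nonneg.2 (hlapo x y h1 h2).ge)) y hy
    have h2 := nonneg_closure (hpos x) ((continuous_const (y := γ)).sub hc)
      (fun y h1 h2 => (sub_nonneg.2 (hlapo x y h1 h2).le)) y hy
    simp only [Pi.sub_apply] at h1 h2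
    linarith
  set S := compS ψ r (γ - lam) with hSdef
  have hS : Smooth2 S := compS_smooth hψ _ _
  have hsurf : ∀ x, S x (η x) = 0 := by
    intro x
    have h1 := hw.sol.bernoulli x
    have h2 := hw.sol.surface_val x
    simp only [hSdef, compS, h2]
    linarith
  have hSnn : ∀ x y, 0 ≤ y → y ≤ η x → 0 ≤ S x y := by
    refine min_principle_s13 (c := 2 * Λ) hS hηc hpos (by linarith) hw.eta_periodic ?_ ?_ ?_ hsurf
    · intro x y
      have h1 : ∀ y, px ψ (x + 2 * Λ) y = px ψ x y := by
        intro y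
        unfold px
        rw [← deriv_comp_add_const]
        simp only [hw.psi_periodic]
      have h2 : py ψ (x + 2 * Λ) y = py ψ x y := by
        unfold py
        simp only [hw.psi_periodic]
      simp only [hSdef, compS, h1, h2, hw.psi_periodic]
    · intro x y h0 h1
      have hx : px (px (px ψ)) x y + px (py (py ψ)) x y = 0 := by
        have e := ((hψ.px.px.hx x y).add (hψ.py.py.hx x y)).deriv
        rw [← e]
        have : (fun t => px (px ψ) t y) + (fun t => py (py ψ) t y) =ᶠ[nhds x] fun _ => γ := by
          filter_upwards [hηc.continuousAt.eventually (lt_mem_nhds h1)] with t ht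
          exact hlapo t y h0 ht
        rw [this.deriv_eq]; simp
      have hy : py (px (px ψ)) x y + py (py (py ψ)) x y = 0 := by
        have e := ((hψ.px.px.hy x y).add (hψ.py.py.hy x y)).deriv
        rw [← e]
        have : (fun t => px (px ψ) x t) + (fun t => py (py ψ) x t) =ᶠ[nhds y] fun _ => γ := by
          filter_upwards [Ioo_mem_nhds h0 h1] with t ht
          exact hlapo x t ht.1 ht.2
        rw [this.deriv_eq]; simp
      rw [hSdef, compS_pxx hψ, compS_pyy hψ]
      rw [hcomm, hcomm1, ← hcomm, ← hcomm2]
      have hl := hlapo x y h0 h1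
      have hb : py (py ψ) x y = γ - px (px ψ) x y := by linarith
      have hA : px (py (py ψ)) x y = - px (px (px ψ)) x y := by linarith
      have hB : py (py (py ψ)) x y = - py (px (px ψ)) x y := by linarith
      rw [hA, hB, hb]
      nlinarith [sq_nonneg (px (px ψ) x y - γ / 2), sq_nonneg (px (py ψ) x y),
        mul_nonneg hγ.le (sub_nonneg.2 hlam)]
    · intro x
      have h0 : (0 : ℝ) ∈ Icc 0 (η x) := ⟨le_rfl, (hpos x).le⟩
      have hp : ∀ x, px ψ x 0 = 0 := by
        intro x; unfold px; simp only [hw.sol.bottom_val]; simp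
      have hpp : px (px ψ) x 0 = 0 := by
        show deriv (fun t => px ψ t 0) x = 0
        simp only [hp]; simp
      have h1 := hun x 0 h0
      have h2 := hlapc x 0 h0
      rw [hpp, zero_add] at h2
      rw [hSdef, compS_py hψ]
      simp only [hp, h2]
      have : 0 ≤ lam * py ψ x 0 := mul_nonneg (by linarith) h1
      linarith
  have hSy : ∀ x, py S x (η x) ≤ 0 := fun x =>
    deriv_nonpos_of_left (hpos x) (hS.hy x (η x)) (fun t ht => by
      rw [hsurf]; exact hSnn x t ht.1 ht.2)
  -- derivative of ζ
  have hζ : ∀ x, HasDerivAt (fun x => py ψ x (η x) - lam * η x)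
      (px (py ψ) x (η x) + deriv η x * py (py ψ) x (η x) - lam * deriv η x) x := fun x =>
    (hψ.py.graph (hηd x)).sub ((hηd x).const_mul lam)
  have hkey : ∀ x, py ψ x (η x) *
      (px (py ψ) x (η x) + deriv η x * py (py ψ) x (η x) - lam * deriv η x)
      = deriv η x * py S x (η x) := by
    intro x
    have h1 : px S x (η x) + deriv η x * py S x (η x) = 0 := by
      rw [← (hS.graph (hηd x)).deriv]
      simp only [hsurf]; simp
    have h2 : px ψ x (η x) + deriv η x * py ψ x (η x) = 0 := by
      rw [← (hψ.graph (hηd x)).deriv]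
      simp only [hw.sol.surface_val]; simp
    have h3 := hlapc x (η x) ⟨(hpos x).le, le_rfl⟩
    have h4 : deriv η x * py S x (η x) = - px S x (η x) := by linarith
    have h5 : px ψ x (η x) = - (deriv η x * py ψ x (η x)) := by linarith
    have h6 : px (px ψ) x (η x) = γ - py (py ψ) x (η x) := by linarith
    rw [h4, hSdef, compS_px hψ]
    simp only [h5, h6]
    ring
  have hη' : ∀ x ∈ Ioo 0 Λ, deriv η x ≤ 0 := by
    intro x hx
    rw [← derivWithin_of_isOpen isOpen_Ioo hx]
    exact (hw.eta_anti.antitoneOn.mono Ioo_subset_Icc_self).derivWithin_nonpos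
  have hmono : MonotoneOn (fun x => py ψ x (η x) - lam * η x) (Icc 0 Λ) := by
    apply monotoneOn_of_deriv_nonneg (convex_Icc 0 Λ)
    · exact fun x _ => (hζ x).continuousAt.continuousWithinAt
    · exact fun x _ => (hζ x).differentiableAt.differentiableWithinAt
    · intro x hx
      rw [interior_Icc] at hx
      rw [(hζ x).deriv]
      have hupos : 0 < py ψ x (η x) := by
        refine lt_of_le_of_ne (hun x (η x) ⟨(hpos x).le, le_rfl⟩) (fun h0 => ?_)
        have h2 : px ψ x (η x) + deriv η x * py ψ x (η x) = 0 := by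
          rw [← (hψ.graph (hηd x)).deriv]
          simp only [hw.sol.surface_val]; simp
        rw [← h0, mul_zero, add_zero] at h2
        have h3 := hw.sol.bernoulli x
        rw [h2, ← h0] at h3
        have h4 := hw.sol.bernoulli 0
        have h5 := hw.eta_anti ⟨le_rfl, hΛ.le⟩ ⟨hx.1.le, hx.2.le⟩ hx.1
        nlinarith [sq_nonneg (px ψ 0 (η 0)), sq_nonneg (py ψ 0 (η 0))]
      have h7 : 0 ≤ py ψ x (η x) *
          (px (py ψ) x (η x) + deriv η x * py (py ψ) x (η x) - lam * deriv η x) := by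
        rw [hkey]
        exact mul_nonneg_of_nonpos_of_nonpos (hη' x hx) (hSy x)
      exact nonneg_of_mul_nonneg_right h7 hupos
  have hfin : ∀ x ∈ Icc 0 Λ, py ψ 0 (η 0) - lam * η 0 ≤ py ψ x (η x) - lam * η x :=
    fun x hx => hmono ⟨le_rfl, hΛ.le⟩ hx hx.1
  have hpyper : ∀ x, py ψ (x + 2 * Λ) = py ψ x := by
    intro x; funext y; unfold py; simp only [hw.psi_periodic]
  have hpyev : ∀ x, py ψ (-x) = py ψ x := by
    intro x; funext y; unfold py; simp only [hw.psi_even]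
  intro x
  have hper : Function.Periodic (fun x => py ψ x (η x) - lam * η x) (2 * Λ) := by
    intro x
    simp only [hpyper, hw.eta_periodic]
  obtain ⟨x', h1, h2⟩ := hper.exists_mem_Ico (by linarith) x (-Λ)
  rw [h2]
  rcases le_total 0 x' with h | h
  · exact hfin x' ⟨h, by linarith [h1.2]⟩
  · have := hfin (-x') ⟨by linarith, by linarith [h1.1]⟩
    rwa [hpyev, hw.eta_even] at this
end
end
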